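/- arXiv:math/0407324 — 6 statements merged into one kernel-verified Lean document; each statement's English description precedes it below -/
import Mathlib

section
/- Let p be an odd prime and let n, m be integers with 0 < n < m. Then the automorphism group of the abelian group ℤ/pⁿ × ℤ/pᵐ has order p^{3n+m-2}·(p-1)². -/
theorem inj_of_torsion {G H : Type*} [AddCommGroup G] [AddCommGroup H] (p k : ℕ)
    (hG : ∀ x : G, p ^ k • x = 0) (g : G →+ H)
    (h : ∀ x, p • x = 0 → g x = 0 → x = 0) : Function.Injective g := by
  rw [injective_iff_map_eq_zero]
  have key : ∀ j : ℕ, ∀ x : G, p ^ j • x = 0 → g x = 0 → x = 0 := by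
    intro j
    induction j with
    | zero => intro x hx _; simpa using hx
    | succ j ih =>
      intro x hx hg
      apply h x _ hg
      apply ih
      · rw [smul_smul, ← pow_succ]; exact hx
      · rw [map_nsmul, hg, smul_zero]
  exact fun x hx => key k x (hG x) hx

theorem map_tors_zero (p n m : ℕ) (hp : p.Prime) (hnm : n < m)
    (b : ZMod (p ^ m) →+ ZMod (p ^ n)) (y : ZMod (p ^ m)) (hy : p • y = 0) : b y = 0 := by
  have : NeZero (p ^ m) := ⟨pow_ne_zero _ hp.ne_zero⟩
  obtain ⟨k, rfl⟩ := ZMod.natCast_zmod_surjective y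
  have h1 : p ^ m ∣ p * k := by
    rw [← ZMod.natCast_eq_zero_iff]
    simpa using hy
  obtain ⟨l, rfl⟩ : ∃ l, m = l + 1 := ⟨m - 1, by omega⟩
  rw [pow_succ', Nat.mul_dvd_mul_iff_left hp.pos] at h1
  have h2 : p ^ n ∣ k := (pow_dvd_pow p (by omega)).trans h1
  have h3 : b (k : ZMod (p ^ (l + 1))) = k • b 1 := by
    rw [← map_nsmul]; simp
  rw [h3, nsmul_eq_mul, (ZMod.natCast_eq_zero_iff _ _).2 h2, zero_mul]

theorem block_inj_iff {A B : Type*} [AddCommGroup A] [AddCommGroup B] [Finite B] (p n m : ℕ)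
    (hA : ∀ x : A, p ^ n • x = 0) (hB : ∀ x : B, p ^ m • x = 0)
    (f : A × B →+ A × B)
    (hb : ∀ y : B, p • y = 0 → (f (0, y)).1 = 0) (N : ℕ)
    (hN : ∀ x : A × B, p ^ N • x = 0) :
    Function.Injective f ↔
      Function.Injective (((AddMonoidHom.fst A B).comp f).comp (AddMonoidHom.inl A B)) ∧
      Function.Injective (((AddMonoidHom.snd A B).comp f).comp (AddMonoidHom.inr A B)) := by
  have hsplit : ∀ x y, f (x, y) = f (x, 0) + f (0, y) := by
    intro x y; rw [← map_add]; simp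
  constructor
  · intro hf
    rw [injective_iff_map_eq_zero] at hf
    have hd : Function.Injective
        (((AddMonoidHom.snd A B).comp f).comp (AddMonoidHom.inr A B)) := by
      apply inj_of_torsion p m hB
      intro y hy hy2
      have := hf (0, y) (Prod.ext (hb y hy) hy2)
      simpa using this
    refine ⟨?_, hd⟩
    apply inj_of_torsion p n hA
    intro x hx hx2
    obtain ⟨y, hy⟩ := (Finite.injective_iff_surjective.1 hd) (f (x, 0)).2
    have hpy : p • y = 0 := by
      apply hd
      rw [map_nsmul, hy, map_zero, ← Prod.smul_snd, ← map_nsmul]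
      have h00 : f (0, 0) = 0 := map_zero f
      simp [hx, h00]
    have h0 : f (x, -y) = 0 := by
      have h1 : f (0, -y) = - f (0, y) := by rw [← map_neg]; simp
      rw [hsplit, h1]
      have hx3 : (f (x, 0)).1 = 0 := hx2
      have hy3 : (f (0, y)).2 = (f (x, 0)).2 := hy
      ext
      · simp [hx3, hb y hpy]
      · simp [hy3]
    have := hf _ h0
    exact (Prod.ext_iff.1 this).1
  · rintro ⟨ha, hd⟩
    apply inj_of_torsion p N hN
    rintro ⟨x, y⟩ hxy h0
    have hy : p • y = 0 := (Prod.ext_iff.1 hxy).2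
    rw [hsplit] at h0
    have h1 := (Prod.ext_iff.1 h0).1
    have h2 := (Prod.ext_iff.1 h0).2
    simp only [Prod.fst_add, Prod.snd_add, hb y hy, add_zero, Prod.fst_zero, Prod.snd_zero]
      at h1 h2
    have hx : x = 0 := ha (by rw [map_zero]; exact h1)
    subst hx
    have h3 : f (0, 0) = 0 := map_zero f
    rw [h3] at h2
    have hy0 : y = 0 := hd (by rw [map_zero]; simpa using h2)
    subst hy0
    rfl

/-- Endomorphisms of a product as block matrices. -/
def blockEquiv (A B : Type*) [AddCommGroup A] [AddCommGroup B] :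
    (A × B →+ A × B) ≃ ((A →+ A) × (B →+ B)) × ((B →+ A) × (A →+ B)) where
  toFun f := ((((AddMonoidHom.fst A B).comp f).comp (AddMonoidHom.inl A B),
      ((AddMonoidHom.snd A B).comp f).comp (AddMonoidHom.inr A B)),
    (((AddMonoidHom.fst A B).comp f).comp (AddMonoidHom.inr A B),
      ((AddMonoidHom.snd A B).comp f).comp (AddMonoidHom.inl A B)))
  invFun q := (q.1.1.coprod q.2.1).prod (q.2.2.coprod q.1.2)
  left_inv f := by
    ext x <;> simp
  right_inv q := by
    obtain ⟨⟨a, d⟩, b, c⟩ := q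
    refine Prod.ext (Prod.ext ?_ ?_) (Prod.ext ?_ ?_) <;> ext x <;> simp

/-- Automorphisms of a finite group are the injective endomorphisms. -/
noncomputable def autEquiv (A : Type*) [AddCommGroup A] [Finite A] :
    AddAut A ≃ {f : A →+ A // Function.Injective f} where
  toFun e := ⟨e.toAddMonoidHom, e.injective⟩
  invFun f := AddEquiv.ofBijective f.1 ⟨f.2, Finite.injective_iff_surjective.1 f.2⟩
  left_inv e := by ext x; rfl
  right_inv f := by ext x; rfl

theorem card_zmod_hom (N : ℕ) (G : Type*) [AddCommGroup G] :
    Nat.card (ZMod N →+ G) = Nat.card {x : G // N • x = 0} := by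
  refine Nat.card_congr ((ZMod.lift N (A := G)).symm.trans
    (Equiv.subtypeEquiv (zmultiplesHom G).symm ?_))
  intro f
  have : f (N : ℤ) = N • f 1 := by rw [← map_nsmul]; simp
  rw [this]
  rfl

theorem card_tors (p n m : ℕ) (hp : p.Prime) (hnm : n ≤ m) :
    Nat.card {x : ZMod (p ^ m) // p ^ n • x = 0} = p ^ n := by
  have : NeZero (p ^ m) := ⟨pow_ne_zero _ hp.ne_zero⟩
  have h := IsAddCyclic.card_nsmulAddMonoidHom_ker (G := ZMod (p ^ m)) (p ^ n)
  rw [Nat.card_zmod, Nat.gcd_eq_right (pow_dvd_pow p hnm)] at h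
  exact h

theorem card_aut_zmod (p n : ℕ) (hp : p.Prime) (hn : 0 < n) :
    Nat.card (AddAut (ZMod (p ^ n))) = p ^ (n - 1) * (p - 1) := by
  have : NeZero (p ^ n) := ⟨pow_ne_zero _ hp.ne_zero⟩
  rw [Nat.card_congr (ZMod.AddAutEquivUnits (p ^ n)).toEquiv,
    Nat.card_congr Additive.toMul, Nat.card_eq_fintype_card, ZMod.card_units_eq_totient,
    Nat.totient_prime_pow hp hn]

/-- For an odd prime `p` and integers `0 < n < m`, the automorphism
group of `ℤ/pⁿ × ℤ/pᵐ` has order `p^(3n+m-2) * (p-1)^2`. -/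
theorem card_addAut_zmod_prod (p n m : ℕ) (hp : p.Prime) (hodd : Odd p)
    (hn : 0 < n) (hnm : n < m) :
    Nat.card (AddAut (ZMod (p ^ n) × ZMod (p ^ m))) =
      p ^ (3 * n + m - 2) * (p - 1) ^ 2 := by
  have : NeZero (p ^ n) := ⟨pow_ne_zero _ hp.ne_zero⟩
  have : NeZero (p ^ m) := ⟨pow_ne_zero _ hp.ne_zero⟩
  have hA : ∀ k, ∀ x : ZMod (p ^ k), p ^ k • x = 0 := by
    intro k x
    rw [nsmul_eq_mul, ZMod.natCast_self, zero_mul]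
  have hA' : ∀ x : ZMod (p ^ n), p ^ m • x = 0 := by
    intro x
    rw [nsmul_eq_mul, (ZMod.natCast_eq_zero_iff _ _).2 (pow_dvd_pow p hnm.le), zero_mul]
  have e1 : {f : ZMod (p ^ n) × ZMod (p ^ m) →+ ZMod (p ^ n) × ZMod (p ^ m) //
      Function.Injective f} ≃
      {q : ((ZMod (p ^ n) →+ ZMod (p ^ n)) × (ZMod (p ^ m) →+ ZMod (p ^ m))) ×
        ((ZMod (p ^ m) →+ ZMod (p ^ n)) × (ZMod (p ^ n) →+ ZMod (p ^ m))) //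
        (Function.Injective q.1.1 ∧ Function.Injective q.1.2) ∧ True} := by
    refine Equiv.subtypeEquiv (blockEquiv _ _) ?_
    intro f
    rw [and_true]
    exact block_inj_iff p n m (hA n) (hA m) f
      (fun y hy => map_tors_zero p n m hp hnm
        (((AddMonoidHom.fst _ _).comp f).comp (AddMonoidHom.inr _ _)) y hy) m
      (fun x => Prod.ext (hA' x.1) (hA m x.2))
  have e2 := e1.trans (Equiv.subtypeProdEquivProd
    (p := fun q : (ZMod (p ^ n) →+ ZMod (p ^ n)) × (ZMod (p ^ m) →+ ZMod (p ^ m)) =>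
      Function.Injective q.1 ∧ Function.Injective q.2) (q := fun _ => True))
  have e3 : {q : (ZMod (p ^ n) →+ ZMod (p ^ n)) × (ZMod (p ^ m) →+ ZMod (p ^ m)) //
      Function.Injective q.1 ∧ Function.Injective q.2} ≃ _ := Equiv.subtypeProdEquivProd
    (p := fun q : (ZMod (p ^ n) →+ ZMod (p ^ n)) => Function.Injective q)
    (q := fun q : (ZMod (p ^ m) →+ ZMod (p ^ m)) => Function.Injective q)
  have c1 : Nat.card (ZMod (p ^ m) →+ ZMod (p ^ n)) = p ^ n := by
    rw [card_zmod_hom, Nat.card_congr (Equiv.subtypeUnivEquiv hA'), Nat.card_zmod]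
  have c2 : Nat.card (ZMod (p ^ n) →+ ZMod (p ^ m)) = p ^ n := by
    rw [card_zmod_hom, card_tors p n m hp hnm.le]
  rw [Nat.card_congr (autEquiv _), Nat.card_congr e2, Nat.card_prod, Nat.card_congr e3,
    Nat.card_prod, ← Nat.card_congr (autEquiv _), ← Nat.card_congr (autEquiv _),
    card_aut_zmod p n hp hn, card_aut_zmod p m hp (hn.trans hnm),
    Nat.card_congr (Equiv.subtypeUnivEquiv (fun _ => trivial)), Nat.card_prod, c1, c2]
  have : 3 * n + m - 2 = (n - 1) + (m - 1) + n + n := by omega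
  rw [this, pow_add, pow_add, pow_add]
  ring
end

section
/- Let G be a finite group and let A be a G-module whose underlying abelian group is finite of odd order. Suppose there is an element z in the center of G that acts on A by negation, i.e. z·x = -x for all x ∈ A. Then the group cohomology Hᵏ(G, A) vanishes for every k ≥ 0. -/
open CategoryTheory

lemma rep_hom_ext {k G : Type} [CommRing k] [Group G] {B C : Rep k G} {f g : B ⟶ C}
    (h : ∀ x, f.hom x = g.hom x) : f = g :=
  Rep.hom_ext (Representation.IntertwiningMap.ext (LinearMap.ext h))

/-- The action of a central element as an endomorphism of a representation. -/
noncomputable def centralHom {k G : Type} [CommRing k] [Group G] (z : G) (hz : z ∈ Subgroup.center G)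
    (B : Rep k G) : B ⟶ B :=
  Rep.ofHom ⟨B.ρ z, fun g => by
    have h : z * g = g * z := (Subgroup.mem_center_iff.1 hz g).symm
    change B.ρ z * B.ρ g = B.ρ g * B.ρ z
    rw [← map_mul, ← map_mul, h]⟩

lemma centralHom_apply {k G : Type} [CommRing k] [Group G] (z : G) (hz : z ∈ Subgroup.center G)
    (B : Rep k G) (x : B) : (centralHom z hz B).hom x = B.ρ z x := rfl

lemma centralHom_comm {k G : Type} [CommRing k] [Group G] (z : G) (hz : z ∈ Subgroup.center G)
    {B C : Rep k G} (f : B ⟶ C) : centralHom z hz B ≫ f = f ≫ centralHom z hz C := by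
  refine rep_hom_ext fun x => ?_
  exact Rep.hom_comm_apply f z x

lemma centralHom_trivial {k G : Type} [CommRing k] [Group G] (z : G) (hz : z ∈ Subgroup.center G) :
    centralHom z hz (Rep.trivial k G k) = 𝟙 _ := rfl

/-- The action of a central element on a complex of representations. -/
noncomputable def centralMap {k G : Type} [CommRing k] [Group G] (z : G) (hz : z ∈ Subgroup.center G)
    (K : ChainComplex (Rep k G) ℕ) : K ⟶ K where
  f n := centralHom z hz (K.X n)
  comm' _ _ _ := centralHom_comm z hz _

/-- On a projective resolution of the trivial representation, a central element acts
homotopically to the identity. -/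
noncomputable def centralHomotopy {k G : Type} [CommRing k] [Group G] (z : G) (hz : z ∈ Subgroup.center G)
    (P : ProjectiveResolution (Rep.trivial k G k)) :
    Homotopy (𝟙 P.complex) (centralMap z hz P.complex) :=
  ProjectiveResolution.liftHomotopy (𝟙 _) _ _ (by simp) (by
    rw [CategoryTheory.Functor.map_id, Category.comp_id]
    ext : 1
    refine (centralHom_comm z hz (P.π.f 0)).trans ?_
    exact Category.comp_id (P.π.f 0))

/-- Let `G` be a finite group and `A` a `G`-module whose underlying
abelian group is finite of odd order. If some central element `z` of `G` acts on
`A` by negation, then `Hᵏ(G, A) = 0` for every `k ≥ 0`. -/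
theorem groupCohomology_subsingleton_of_central_neg (G : Type) [Group G] [Finite G]
    (A : Rep ℤ G) (hfin : Finite A) (hodd : Odd (Nat.card A))
    (z : G) (hz : z ∈ Subgroup.center G)
    (hneg : ∀ x : A, A.ρ z x = -x) :
    ∀ k : ℕ, Subsingleton (groupCohomology A k) := by
  intro n
  let P := Rep.barResolution ℤ G
  apply ModuleCat.subsingleton_of_isZero
  refine Limits.IsZero.of_iso ?_ (groupCohomologyIso A n P)
  rw [← HomologicalComplex.exactAt_iff_isZero_homology,
    HomologicalComplex.exactAt_iff' _ (n - 1) n (n + 1) (by cases n <;> simp) (by simp),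
    ShortComplex.moduleCat_exact_iff]
  intro (φ : P.complex.X n ⟶ A) hφ
  have hφ2 : P.complex.d (n + 1) n ≫ φ = 0 := hφ
  obtain ⟨m, hm⟩ := hodd
  have hzA : centralHom z hz A = -𝟙 A := by
    refine rep_hom_ext fun x => ?_
    exact hneg x
  have hA : ∀ x : A, ((2 * m + 1 : ℕ)) • x = 0 := fun x => by
    rw [← hm]
    exact card_nsmul_eq_zero'
  have hcard : (2 * m + 1 : ℕ) • φ = 0 := by
    refine rep_hom_ext fun x => ?_
    exact hA (φ.hom x)
  let h := centralHomotopy z hz P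
  have hc := h.comm n
  rw [dNext_nat, prevD_eq _ (show (ComplexShape.down ℕ).Rel (n + 1) n by simp)] at hc
  have hc2 := congrArg (fun f => f ≫ (-(m • φ))) hc
  have hzφ : (centralMap z hz P.complex).f n ≫ φ = -φ := by
    refine (centralHom_comm z hz φ).trans ?_
    rw [hzA]; simp
  refine ⟨(h.hom (n - 1) n ≫ (-(m • φ)) : P.complex.X (n - 1) ⟶ A), ?_⟩
  change P.complex.d n (n - 1) ≫ h.hom (n - 1) n ≫ (-(m • φ)) = φ
  have hd : (h.hom n (n + 1) ≫ P.complex.d (n + 1) n) ≫ (-(m • φ)) = 0 := by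
    rw [Category.assoc, Preadditive.comp_neg, Preadditive.comp_nsmul, hφ2, smul_zero, neg_zero]
    exact Limits.comp_zero
  have hz2 : (centralMap z hz P.complex).f n ≫ (-(m • φ)) = m • φ := by
    rw [Preadditive.comp_neg, Preadditive.comp_nsmul, hzφ, smul_neg, neg_neg]
  have hc3 : -(m • φ) = P.complex.d n (n - 1) ≫ h.hom (n - 1) n ≫ (-(m • φ)) + m • φ := by
    simp only [Preadditive.add_comp] at hc2
    rw [hd, hz2, add_zero, Category.assoc] at hc2
    exact (Category.id_comp _).symm.trans hc2
  rw [add_smul, mul_smul, one_smul, two_smul] at hcard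
  have e : φ = -(m • φ) - m • φ := by
    rw [← sub_eq_zero, ← hcard]; abel
  exact (e.trans (sub_eq_of_eq_add hc3)).symm
end

section
/- Let p be an odd prime, r ≥ 4 an integer, and G a group of order p^r generated by elements a, b, c satisfying a^p = b^p = c^{p^{r-2}} = 1, [a,b] = c^{p^{r-3}}, and c ∈ Z(G). Then the automorphism group of G has order p^r·(p-1)²·(p+1). -/
namespace Cpr

variable {G : Type} [Group G]

/-- The relations of `C(p, n+3)`. -/
structure Rel (p n : ℕ) (x y w : G) : Prop where
  hx : x ^ p = 1
  hy : y ^ p = 1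
  hw : ∀ g : G, w * g = g * w
  hwp : w ^ p ^ (n + 1) = 1
  hxy : x * y = y * x * w ^ p ^ n

/-- Normal form words. -/
def E (x y w : G) (i j k : ℤ) : G := x ^ i * y ^ j * w ^ k

theorem zpow_one_of_dvd {x : G} {m : ℕ} (h : x ^ m = 1) {i : ℤ} (hi : (m : ℤ) ∣ i) : x ^ i = 1 := by
  obtain ⟨k, rfl⟩ := hi
  rw [zpow_mul, zpow_natCast, h, one_zpow]

theorem zpow_congr {x : G} {m : ℕ} (h : x ^ m = 1) {i j : ℤ} (hi : (m : ℤ) ∣ i - j) :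
    x ^ i = x ^ j := by
  have := zpow_one_of_dvd h hi
  rw [zpow_sub] at this
  exact mul_inv_eq_one.mp this

variable {p n : ℕ} {x y w : G}

theorem Rel.comm (h : Rel p n x y w) (k : ℤ) (g : G) : Commute (w ^ k) g :=
  Commute.zpow_left (h.hw g) k

theorem Rel.swap1 (h : Rel p n x y w) (j : ℤ) :
    y ^ j * x = x * (y ^ j * w ^ (-((p:ℤ) ^ n * j))) := by
  have h1 : x * y * x⁻¹ = y * w ^ (p ^ n) := by
    have hc : Commute (w ^ p ^ n) x := Commute.pow_left (h.hw x) _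
    rw [h.hxy, mul_assoc y, ← hc.eq]; group
  have h2 : x * y ^ j * x⁻¹ = y ^ j * w ^ ((p:ℤ) ^ n * j) := by
    rw [← conj_zpow, h1, Commute.mul_zpow]
    · rw [← zpow_natCast w, ← zpow_mul]; push_cast; rfl
    · exact (Commute.pow_left (h.hw y) _).symm
  have h3 : x * y ^ j = y ^ j * w ^ ((p:ℤ) ^ n * j) * x := by
    rw [← h2]; group
  rw [← mul_assoc, h3, mul_assoc (y ^ j), (h.comm _ x).eq, ← mul_assoc, mul_assoc, ← zpow_add]
  simp

theorem Rel.swap (h : Rel p n x y w) (i j : ℤ) :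
    y ^ j * x ^ i = x ^ i * (y ^ j * w ^ (-((p:ℤ) ^ n * i * j))) := by
  have h1 : x⁻¹ * y ^ j * x = y ^ j * w ^ (-((p:ℤ) ^ n * j)) := by
    rw [mul_assoc, h.swap1]; group
  have key : ∀ m : ℕ, y ^ j * x ^ m = x ^ m * (y ^ j * w ^ (-((p:ℤ) ^ n * m * j))) := by
    intro m
    induction m with
    | zero => simp
    | succ m ih =>
      rw [pow_succ, ← mul_assoc, ih, mul_assoc, mul_assoc, (h.comm _ x).eq, ← mul_assoc (y ^ j),
        h.swap1]
      simp only [mul_assoc]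
      rw [← zpow_add]
      congr 4
      push_cast; ring_nf
  rcases Int.eq_nat_or_neg i with ⟨m, rfl | rfl⟩
  · simpa using key m
  · have := key m
    rw [zpow_neg, zpow_natCast, mul_inv_eq_iff_eq_mul]
    have h4 : y ^ j = x ^ m * (y ^ j * w ^ (-((p:ℤ) ^ n * m * j))) * (x ^ m)⁻¹ := by
      rw [← this]; group
    rw [mul_assoc, mul_assoc, (h.comm _ _).eq, ← mul_assoc (y ^ j), this]
    simp only [mul_assoc]
    rw [← zpow_add]
    simp

theorem E_mul (h : Rel p n x y w) (i j k i' j' k' : ℤ) :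
    E x y w i j k * E x y w i' j' k' =
      E x y w (i + i') (j + j') (k + k' - (p:ℤ) ^ n * i' * j) := by
  unfold E
  have : x ^ i * y ^ j * w ^ k * (x ^ i' * y ^ j' * w ^ k') =
      x ^ i * (y ^ j * x ^ i') * y ^ j' * w ^ k * w ^ k' := by
    have := (h.comm k (x ^ i' * y ^ j')).eq
    calc _ = x ^ i * y ^ j * (w ^ k * (x ^ i' * y ^ j')) * w ^ k' := by simp only [mul_assoc]
      _ = _ := by rw [this]; simp only [mul_assoc]
  rw [this, h.swap]
  have h2 := (h.comm (-((p:ℤ) ^ n * i' * j)) (y ^ j')).eq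
  calc _ = x ^ i * x ^ i' * y ^ j * (w ^ (-((p:ℤ) ^ n * i' * j)) * y ^ j') * w ^ k * w ^ k' := by
        simp only [mul_assoc]
    _ = x ^ i * x ^ i' * (y ^ j * y ^ j') * (w ^ (-((p:ℤ) ^ n * i' * j)) * w ^ k * w ^ k') := by
        rw [h2]; simp only [mul_assoc]
    _ = _ := by
        simp only [← zpow_add]; congr 2; ring

theorem E_pow (h : Rel p n x y w) (i j k : ℤ) (m : ℕ) :
    E x y w i j k ^ m = E x y w (m * i) (m * j) (m * k - (p:ℤ) ^ n * i * j * (m.choose 2 : ℕ)) := by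
  induction m with
  | zero => simp [E]
  | succ m ih =>
    rw [pow_succ, ih, E_mul h]
    have : (m + 1).choose 2 = m.choose 2 + m := by
      rw [Nat.choose_succ_succ' m 1, Nat.choose_one_right, add_comm]
    rw [this]
    push_cast
    congr 1 <;> ring

theorem orderOf_w (hp : p.Prime) (h : Rel p n x y w) (hne : w ^ p ^ n ≠ 1) :
    orderOf w = p ^ (n + 1) := by
  have := Fact.mk hp
  exact orderOf_eq_prime_pow hne h.hwp

theorem w_dvd (hp : p.Prime) (h : Rel p n x y w) (hne : w ^ p ^ n ≠ 1) {k : ℤ} :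
    w ^ k = 1 ↔ (p:ℤ) ^ (n + 1) ∣ k := by
  rw [← orderOf_dvd_iff_zpow_eq_one, orderOf_w hp h hne]; push_cast; rfl

theorem w_dvd' (hp : p.Prime) (h : Rel p n x y w) (hne : w ^ p ^ n ≠ 1) {k k' : ℤ} :
    w ^ k = w ^ k' ↔ (p:ℤ) ^ (n + 1) ∣ k - k' := by
  rw [← w_dvd hp h hne, zpow_sub, mul_inv_eq_one]

theorem cancel_p (hp : p.Prime) {k : ℤ} : (p:ℤ) ^ (n + 1) ∣ (p:ℤ) ^ n * k ↔ (p:ℤ) ∣ k := by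
  rw [pow_succ]
  exact mul_dvd_mul_iff_left (pow_ne_zero _ (by exact_mod_cast hp.ne_zero))

theorem dvd_of_comm_x (hp : p.Prime) (h : Rel p n x y w) (hne : w ^ p ^ n ≠ 1) {i j k : ℤ}
    (hc : E x y w i j k * x = x * E x y w i j k) : (p:ℤ) ∣ j := by
  have e : x = E x y w 1 0 0 := by simp [E]
  have h1 : E x y w i j k * E x y w 1 0 0 = E x y w 1 0 0 * E x y w i j k := by
    rw [← e]; exact hc
  rw [E_mul h, E_mul h, add_comm 1 i, add_comm 0 j, E, E] at h1
  have h2 := mul_left_cancel h1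
  rw [w_dvd' hp h hne] at h2
  rw [← cancel_p (n := n) hp]
  have h3 := (dvd_neg (α := ℤ)).2 h2
  ring_nf at h3 ⊢
  exact h3

theorem dvd_of_comm_y (hp : p.Prime) (h : Rel p n x y w) (hne : w ^ p ^ n ≠ 1) {i j k : ℤ}
    (hc : E x y w i j k * y = y * E x y w i j k) : (p:ℤ) ∣ i := by
  have e : y = E x y w 0 1 0 := by simp [E]
  have h1 : E x y w i j k * E x y w 0 1 0 = E x y w 0 1 0 * E x y w i j k := by
    rw [← e]; exact hc
  rw [E_mul h, E_mul h, add_comm 0 i, add_comm 1 j, E, E] at h1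
  have h2 := mul_left_cancel h1
  rw [w_dvd' hp h hne] at h2
  rw [← cancel_p (n := n) hp]
  convert h2 using 1; ring

theorem E_eq_one (hp : p.Prime) (h : Rel p n x y w) (hne : w ^ p ^ n ≠ 1) {i j k : ℤ} :
    E x y w i j k = 1 ↔ (p:ℤ) ∣ i ∧ (p:ℤ) ∣ j ∧ (p:ℤ) ^ (n + 1) ∣ k := by
  constructor
  · intro h1
    have hi : (p:ℤ) ∣ i := dvd_of_comm_y hp h hne (by rw [h1]; simp)
    have hj : (p:ℤ) ∣ j := dvd_of_comm_x hp h hne (by rw [h1]; simp)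
    refine ⟨hi, hj, ?_⟩
    rw [E, zpow_one_of_dvd h.hx hi, zpow_one_of_dvd h.hy hj, one_mul, one_mul] at h1
    exact (w_dvd hp h hne).1 h1
  · rintro ⟨hi, hj, hk⟩
    rw [E, zpow_one_of_dvd h.hx hi, zpow_one_of_dvd h.hy hj, (w_dvd hp h hne).2 hk]
    simp

theorem E_eq (hp : p.Prime) (h : Rel p n x y w) (hne : w ^ p ^ n ≠ 1) {i j k i' j' k' : ℤ} :
    E x y w i j k = E x y w i' j' k' ↔
      (p:ℤ) ∣ i - i' ∧ (p:ℤ) ∣ j - j' ∧ (p:ℤ) ^ (n + 1) ∣ k - k' := by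
  constructor
  · intro h1
    have h2 : E x y w i j k = E x y w i' j' k' *
        E x y w (i - i') (j - j') (k - k' + (p:ℤ) ^ n * (i - i') * j') := by
      rw [E_mul h]; congr 1 <;> ring
    rw [h1] at h2
    have h3 := (E_eq_one hp h hne).1 (left_eq_mul.1 h2)
    refine ⟨h3.1, h3.2.1, ?_⟩
    have h4 : (p:ℤ) ^ (n + 1) ∣ (p:ℤ) ^ n * (i - i') * j' :=
      Dvd.dvd.mul_right ((cancel_p hp).2 h3.1) _
    exact (dvd_add_left h4).1 h3.2.2
  · rintro ⟨hi, hj, hk⟩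
    rw [E, E, zpow_congr h.hx hi, zpow_congr h.hy hj, (w_dvd' hp h hne).2 hk]

theorem E_surj (h : Rel p n x y w) (hgen : Subgroup.closure {x, y, w} = ⊤) (g : G) :
    ∃ i j k : ℤ, g = E x y w i j k := by
  have hg : g ∈ Subgroup.closure {x, y, w} := by rw [hgen]; trivial
  induction hg using Subgroup.closure_induction with
  | mem g hg =>
    rcases hg with rfl | rfl | rfl
    · exact ⟨1, 0, 0, by simp [E]⟩
    · exact ⟨0, 1, 0, by simp [E]⟩
    · exact ⟨0, 0, 1, by simp [E]⟩
  | one => exact ⟨0, 0, 0, by simp [E]⟩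
  | mul g g' _ _ hg hg' =>
    obtain ⟨i, j, k, rfl⟩ := hg
    obtain ⟨i', j', k', rfl⟩ := hg'
    exact ⟨_, _, _, E_mul h _ _ _ _ _ _⟩
  | inv g _ hg =>
    obtain ⟨i, j, k, rfl⟩ := hg
    refine ⟨-i, -j, -k - (p:ℤ) ^ n * i * j, ?_⟩
    rw [inv_eq_iff_mul_eq_one, E_mul h]
    have : k + (-k - (p:ℤ) ^ n * i * j) - (p:ℤ) ^ n * -i * j = 0 := by ring
    rw [this]; simp [E]

theorem zpow_val {x : G} {m : ℕ} [NeZero m] (h : x ^ m = 1) (i : ℤ) :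
    x ^ (((i : ZMod m).val : ℕ) : ℤ) = x ^ i := by
  apply zpow_congr h
  rw [ZMod.val_intCast, ← dvd_neg]
  simpa using Int.dvd_self_sub_emod (x := i) (m := m)

theorem ne_one (hp : p.Prime) (h : Rel p n x y w) (hgen : Subgroup.closure {x, y, w} = ⊤)
    (hcard : Nat.card G = p ^ (n + 3)) : w ^ p ^ n ≠ 1 := by
  intro h1
  have := NeZero.mk hp.ne_zero
  have : NeZero (p ^ n) := NeZero.mk (pow_ne_zero _ hp.ne_zero)
  have hs : Function.Surjective (fun t : ZMod p × ZMod p × ZMod (p ^ n) =>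
      E x y w (t.1.val : ℕ) (t.2.1.val : ℕ) (t.2.2.val : ℕ)) := by
    intro g
    obtain ⟨i, j, k, rfl⟩ := E_surj h hgen g
    refine ⟨(i, j, k), ?_⟩
    simp only [E]
    rw [zpow_val h.hx, zpow_val h.hy, zpow_val h1]
  have := Nat.card_le_card_of_surjective _ hs
  rw [hcard, Nat.card_prod, Nat.card_prod, Nat.card_zmod, Nat.card_zmod] at this
  have h2 : p ^ (n + 3) = p * (p * p ^ n) * p := by ring
  have h3 : 0 < p * (p * p ^ n) := by have := hp.pos; positivity
  have := hp.two_le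
  nlinarith

theorem exists_aut (hp : p.Prime) {a b c : G} (h : Rel p n a b c) (hne : c ^ p ^ n ≠ 1)
    (hgen : Subgroup.closure {a, b, c} = ⊤) [Finite G]
    (h' : Rel p n x y w) (hne' : w ^ p ^ n ≠ 1) :
    ∃ φ : MulAut G, φ a = x ∧ φ b = y ∧ φ c = w := by
  choose I J K hE using E_surj h hgen
  have hf : ∀ i j k : ℤ, E x y w (I (E a b c i j k)) (J (E a b c i j k)) (K (E a b c i j k)) =
      E x y w i j k := by
    intro i j k
    rw [E_eq hp h' hne', ← E_eq hp h hne, ← hE]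
  let f : G →* G := MonoidHom.mk' (fun g => E x y w (I g) (J g) (K g)) (by
    intro g g'
    conv_lhs => rw [hE g, hE g', E_mul h]
    rw [hf, E_mul h'])
  have hfE : ∀ i j k : ℤ, f (E a b c i j k) = E x y w i j k := hf
  have hinj : Function.Injective f := by
    rw [injective_iff_map_eq_one]
    intro g hg
    obtain ⟨i, j, k, rfl⟩ := E_surj h hgen g
    rw [hfE, E_eq_one hp h' hne', ← E_eq_one hp h hne] at hg
    exact hg
  refine ⟨MulEquiv.ofBijective f (Finite.injective_iff_bijective.1 hinj), ?_, ?_, ?_⟩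
  · simpa [E] using hfE 1 0 0
  · simpa [E] using hfE 0 1 0
  · simpa [E] using hfE 0 0 1

theorem choose_dvd (hp : p.Prime) (hodd : Odd p) (i j : ℤ) :
    (p:ℤ) ^ (n + 1) ∣ (p:ℤ) ^ n * i * j * (p.choose 2 : ℕ) := by
  have h3 : 2 < p := by
    have := hp.two_le
    rcases hodd with ⟨k, rfl⟩
    omega
  have : p ∣ p.choose 2 := hp.dvd_choose_self (by norm_num) h3
  have h4 : (p:ℤ) ∣ (p.choose 2 : ℕ) := by exact_mod_cast this
  have h5 : (p:ℤ) ^ n * i * j * (p.choose 2 : ℕ) = (p:ℤ) ^ n * (i * j * (p.choose 2 : ℕ)) := by ring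
  rw [h5, cancel_p hp]
  exact h4.mul_left _

theorem E_pow_p (hp : p.Prime) (hodd : Odd p) (h : Rel p n x y w) (hne : w ^ p ^ n ≠ 1)
    (i j k : ℤ) : E x y w i j k ^ p = 1 ↔ (p:ℤ) ^ n ∣ k := by
  rw [E_pow h, E_eq_one hp h hne, dvd_sub_left (choose_dvd hp hodd i j), pow_succ,
    mul_comm ((p:ℤ) ^ n), mul_dvd_mul_iff_left (by exact_mod_cast hp.ne_zero)]
  simp

theorem E_comm (h : Rel p n x y w) (i j k i' j' k' t : ℤ) :
    E x y w i' j' k' * E x y w i j k * w ^ t = E x y w (i + i') (j + j')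
      (k + k' - (p:ℤ) ^ n * i * j' + t) := by
  have : w ^ t = E x y w 0 0 t := by simp [E]
  rw [this, E_mul h, E_mul h]
  congr 1 <;> ring

/-- Condition for the commutator relation. -/
theorem comm_iff (hp : p.Prime) (h : Rel p n x y w) (hne : w ^ p ^ n ≠ 1)
    (i j k i' j' k' t : ℤ) :
    E x y w i j k * E x y w i' j' k' = E x y w i' j' k' * E x y w i j k * (w ^ t) ^ p ^ n ↔
      (p:ℤ) ∣ t - (i * j' - j * i') := by
  have : (w ^ t) ^ p ^ n = w ^ ((p:ℤ) ^ n * t) := by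
    rw [← zpow_natCast, ← zpow_mul, mul_comm]; push_cast; rfl
  rw [this, E_comm h, E_mul h, E_eq hp h hne]
  simp only [sub_self, dvd_zero, true_and]
  have e : k + k' - (p:ℤ) ^ n * i' * j - (k + k' - (p:ℤ) ^ n * i * j' + (p:ℤ) ^ n * t) =
    -((p:ℤ) ^ n * (t - (i * j' - j * i'))) := by ring
  rw [e, dvd_neg, cancel_p hp]

theorem wt_ne (hp : p.Prime) (h : Rel p n x y w) (hne : w ^ p ^ n ≠ 1) (t : ℤ) :
    (w ^ t) ^ p ^ n = 1 ↔ (p:ℤ) ∣ t := by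
  have : (w ^ t) ^ p ^ n = w ^ ((p:ℤ) ^ n * t) := by
    rw [← zpow_natCast, ← zpow_mul, mul_comm]; push_cast; rfl
  rw [this, w_dvd hp h hne, cancel_p hp]

theorem rel_map {x y w : G} (h : Rel p n x y w) (φ : MulAut G) : Rel p n (φ x) (φ y) (φ w) where
  hx := by rw [← map_pow, h.hx, map_one]
  hy := by rw [← map_pow, h.hy, map_one]
  hw g := by
    obtain ⟨g, rfl⟩ := φ.surjective g
    rw [← map_mul, h.hw, map_mul]
  hwp := by rw [← map_pow, h.hwp, map_one]
  hxy := by rw [← map_pow, ← map_mul, h.hxy, map_mul, map_mul]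

/-- Parameters of automorphisms. -/
abbrev Par (p n : ℕ) : Type := GL (Fin 2) (ZMod p) × ZMod p × ZMod p × ZMod (p ^ n)

theorem main (hp : p.Prime) (hodd : Odd p) {a b c : G} (h : Rel p n a b c)
    (hgen : Subgroup.closure {a, b, c} = ⊤) (hcard : Nat.card G = p ^ (n + 3)) :
    Nat.card (MulAut G) = Nat.card (Par p n) := by
  have hne := ne_one hp h hgen hcard
  have : Finite G := Nat.finite_of_card_ne_zero (by rw [hcard]; exact pow_ne_zero _ hp.ne_zero)
  have := Fact.mk hp
  have := NeZero.mk hp.ne_zero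
  have : NeZero (p ^ n) := NeZero.mk (pow_ne_zero _ hp.ne_zero)
  have hex : ∀ q : Par p n, ∃ φ : MulAut G,
      φ a = E a b c (q.1.1 0 0).val (q.1.1 0 1).val ((p:ℤ) ^ n * q.2.1.val) ∧
      φ b = E a b c (q.1.1 1 0).val (q.1.1 1 1).val ((p:ℤ) ^ n * q.2.2.1.val) ∧
      φ c = c ^ ((q.1.1.det.val : ℤ) + p * (q.2.2.2.val : ℤ)) := by
    intro q
    have hz : c ^ (p ^ (n + 1)) = 1 := h.hwp
    apply exists_aut hp h hne hgen
    · refine ⟨(E_pow_p hp hodd h hne _ _ _).2 (dvd_mul_right _ _),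
        (E_pow_p hp hodd h hne _ _ _).2 (dvd_mul_right _ _), fun g => (h.comm _ g).eq, ?_, ?_⟩
      · rw [← zpow_natCast, zpow_comm, zpow_natCast, hz, one_zpow]
      · rw [comm_iff hp h hne, ← ZMod.intCast_zmod_eq_zero_iff_dvd]
        simp [Matrix.det_fin_two]
    · rw [Ne, wt_ne hp h hne, ← ZMod.intCast_zmod_eq_zero_iff_dvd]
      simp only [Int.cast_add, Int.cast_mul, Int.cast_natCast, ZMod.natCast_val,
        CharP.cast_eq_zero, zero_mul, add_zero]
      have := q.1.det.ne_zero
      simpa using this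
  choose F hFa hFb hFc using hex
  symm
  apply Nat.card_eq_of_bijective F
  have hv : ∀ u v : ZMod p, (p:ℤ) ∣ (u.val:ℤ) - v.val → u = v := by
    intro u v huv
    rw [← ZMod.intCast_zmod_eq_zero_iff_dvd] at huv
    simpa [sub_eq_zero] using huv
  constructor
  · intro q q' hq
    have ha := hFa q
    have hb := hFb q
    have hc := hFc q
    rw [hq, hFa, E_eq hp h hne, ← mul_sub, cancel_p hp] at ha
    rw [hq, hFb, E_eq hp h hne, ← mul_sub, cancel_p hp] at hb
    rw [hq, hFc, w_dvd' hp h hne] at hc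
    have hM : q'.1 = q.1 := by
      ext i j
      fin_cases i <;> fin_cases j
      · exact hv _ _ ha.1
      · exact hv _ _ ha.2.1
      · exact hv _ _ hb.1
      · exact hv _ _ hb.2.1
    have hs : q'.2.2.2 = q.2.2.2 := by
      rw [hM, add_sub_add_left_eq_sub, ← mul_sub, pow_succ, mul_comm,
        mul_dvd_mul_iff_left (by exact_mod_cast hp.ne_zero)] at hc
      have hc' : ((p ^ n : ℕ) : ℤ) ∣ (q'.2.2.2.val : ℤ) - q.2.2.2.val := by push_cast; exact hc
      rw [← ZMod.intCast_zmod_eq_zero_iff_dvd] at hc'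
      simpa [sub_eq_zero] using hc'
    exact (Prod.ext hM (Prod.ext (hv _ _ ha.2.2) (Prod.ext (hv _ _ hb.2.2) hs))).symm
  · intro φ
    have hr := rel_map h φ
    obtain ⟨i, j, k, hA⟩ := E_surj h hgen (φ a)
    obtain ⟨i', j', k', hB⟩ := E_surj h hgen (φ b)
    obtain ⟨i0, j0, t, hC⟩ := E_surj h hgen (φ c)
    have hi0 : (p:ℤ) ∣ i0 := dvd_of_comm_y hp h hne (k := t) (j := j0) (by rw [← hC, hr.hw])
    have hj0 : (p:ℤ) ∣ j0 := dvd_of_comm_x hp h hne (k := t) (i := i0) (by rw [← hC, hr.hw])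
    rw [E, zpow_one_of_dvd h.hx hi0, zpow_one_of_dvd h.hy hj0, one_mul, one_mul] at hC
    have hk := hr.hx
    rw [hA, E_pow_p hp hodd h hne] at hk
    have hk' := hr.hy
    rw [hB, E_pow_p hp hodd h hne] at hk'
    have hd := hr.hxy
    rw [hA, hB, hC, comm_iff hp h hne] at hd
    have ht : ¬ (p:ℤ) ∣ t := by
      rw [← wt_ne hp h hne, ← hC, ← map_pow]
      exact fun h0 => hne ((map_eq_one_iff φ φ.injective).1 h0)
    obtain ⟨m, rfl⟩ := hk
    obtain ⟨m', rfl⟩ := hk'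
    let M : Matrix (Fin 2) (Fin 2) (ZMod p) := !![(i : ZMod p), j; i', j']
    have hdM : M.det = (t : ZMod p) := by
      rw [← ZMod.intCast_zmod_eq_zero_iff_dvd] at hd
      push_cast at hd
      rw [sub_eq_zero] at hd
      simp [M, Matrix.det_fin_two, hd]
    have hdet : M.det ≠ 0 := by
      rw [hdM, Ne, ZMod.intCast_zmod_eq_zero_iff_dvd]; exact ht
    have hs : (p:ℤ) ∣ t - M.det.val := by
      rw [← ZMod.intCast_zmod_eq_zero_iff_dvd]; simp [hdM]
    obtain ⟨s, hs⟩ := hs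
    have hval : ∀ u : ℤ, (p:ℤ) ∣ ((u : ZMod p).val : ℤ) - u := by
      intro u
      rw [← ZMod.intCast_zmod_eq_zero_iff_dvd]; simp
    refine ⟨(Matrix.GeneralLinearGroup.mkOfDetNeZero M hdet, (m : ZMod p), (m' : ZMod p),
      (s : ZMod (p ^ n))), ?_⟩
    have e1 : F (Matrix.GeneralLinearGroup.mkOfDetNeZero M hdet, (m : ZMod p), (m' : ZMod p),
      (s : ZMod (p ^ n))) a = φ a := by
      rw [hFa, hA, E_eq hp h hne, ← mul_sub, cancel_p hp]
      exact ⟨hval _, hval _, hval _⟩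
    have e2 : F (Matrix.GeneralLinearGroup.mkOfDetNeZero M hdet, (m : ZMod p), (m' : ZMod p),
      (s : ZMod (p ^ n))) b = φ b := by
      rw [hFb, hB, E_eq hp h hne, ← mul_sub, cancel_p hp]
      exact ⟨hval _, hval _, hval _⟩
    have e3 : F (Matrix.GeneralLinearGroup.mkOfDetNeZero M hdet, (m : ZMod p), (m' : ZMod p),
      (s : ZMod (p ^ n))) c = φ c := by
      rw [hFc, hC, w_dvd' hp h hne]
      have h1 : t = M.det.val + p * s := by linarith
      have h2 : ((p ^ n : ℕ) : ℤ) ∣ ((s : ZMod (p ^ n)).val : ℤ) - s := by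
        rw [← ZMod.intCast_zmod_eq_zero_iff_dvd]; simp
      rw [h1]
      change _ ∣ ((M.det.val : ℤ) + p * ((s : ZMod (p ^ n)).val : ℤ)) - _
      rw [add_sub_add_left_eq_sub, ← mul_sub, pow_succ, mul_comm]
      exact mul_dvd_mul_left _ (by exact_mod_cast h2)
    ext g
    obtain ⟨i, j, k, rfl⟩ := E_surj h hgen g
    simp only [E, map_mul, map_zpow, e1, e2, e3]

theorem card_Par (hp : p.Prime) (n : ℕ) :
    Nat.card (Par p n) = p ^ (n + 3) * (p - 1) ^ 2 * (p + 1) := by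
  have := Fact.mk hp
  rw [Nat.card_prod, Nat.card_prod, Nat.card_prod, Nat.card_zmod, Nat.card_zmod,
    Matrix.card_GL_field]
  simp only [Fin.prod_univ_two, ZMod.card, Fin.val_zero, Fin.val_one, pow_zero, pow_one]
  obtain ⟨q, rfl⟩ : ∃ q, p = q + 1 := ⟨p - 1, by have := hp.pos; omega⟩
  have h1 : (q + 1) ^ 2 - 1 = q * (q + 2) := by
    have : (q + 1) ^ 2 = q * (q + 2) + 1 := by ring
    omega
  have h2 : (q + 1) ^ 2 - (q + 1) = q * (q + 1) := by
    have : (q + 1) ^ 2 = q * (q + 1) + (q + 1) := by ring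
    omega
  rw [h1, h2, Nat.add_sub_cancel]
  ring

end Cpr

/-- Let `p` be an odd prime, `r ≥ 4`, and `G` a group of order `p^r`
generated by `a, b, c` with `a^p = b^p = c^(p^(r-2)) = 1`, `[a,b] = c^(p^(r-3))`
(where `[x,y] = x⁻¹y⁻¹xy`) and `c` central. Then `|Aut(G)| = p^r·(p-1)²·(p+1)`. -/
theorem card_aut_Cpr (p r : ℕ) (hp : p.Prime) (hodd : Odd p) (hr : 4 ≤ r)
    (G : Type) [Group G] (a b c : G)
    (hcard : Nat.card G = p ^ r)
    (hgen : Subgroup.closure {a, b, c} = ⊤)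
    (ha : a ^ p = 1) (hb : b ^ p = 1) (hc : c ^ p ^ (r - 2) = 1)
    (hab : a⁻¹ * b⁻¹ * a * b = c ^ p ^ (r - 3))
    (hcz : c ∈ Subgroup.center G) :
    Nat.card (MulAut G) = p ^ r * (p - 1) ^ 2 * (p + 1) := by
  obtain ⟨n, rfl⟩ : ∃ n, r = n + 3 := ⟨r - 3, by omega⟩
  have e1 : n + 3 - 2 = n + 1 := by omega
  have e2 : n + 3 - 3 = n := by omega
  rw [e1] at hc
  rw [e2] at hab
  have h : Cpr.Rel p n a b c := by
    refine ⟨ha, hb, fun g => ((Subgroup.mem_center_iff.1 hcz) g).symm, hc, ?_⟩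
    rw [← hab]; group
  rw [Cpr.main hp hodd h hgen hcard, Cpr.card_Par hp]
end

section
/- Let k ≥ 2 be an integer. There exists a subgroup H of GL₂(ℤ/3ᵏ) that is isomorphic (as an abstract group) to SL₂(𝔽₃) and contains the matrix [[1,-3],[1,-2]]. Moreover, any two subgroups of GL₂(ℤ/3ᵏ) that are isomorphic to SL₂(𝔽₃) and contain the matrix [[1,-3],[1,-2]] are conjugate in GL₂(ℤ/3ᵏ). -/
namespace Sl2Lift
open Matrix

/-- The matrix of order four in `SL₂(𝔽₃)`. -/
def s3 : SpecialLinearGroup (Fin 2) (ZMod 3) := ⟨!![0,1;-1,0], by decide⟩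

/-- The matrix of order three in `SL₂(𝔽₃)`. -/
def t3 : SpecialLinearGroup (Fin 2) (ZMod 3) := ⟨!![1,0;1,1], by decide⟩

theorem conj_fact : ∀ m : SpecialLinearGroup (Fin 2) (ZMod 3), m*(m*m)=1 → m ≠ 1 →
    ∃ h : SpecialLinearGroup (Fin 2) (ZMod 3), m * h = h * t3 ∨ m * h = h * (t3 * t3) := by
  decide +kernel

theorem fin_fact1 : ∃ i : SpecialLinearGroup (Fin 2) (ZMod 3),
   ((i*i)*(i*i)=1 ∧ i * i ≠ 1 ∧ i * (t3*(i*(t3*t3))) = (i*i) *((t3*(i*(t3*t3)))*i)) ∧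
   (∃ h, i * t3 * h = (i * i) * (h * t3)) ∧
   ∀ x, ∃ (a : Fin 4) (b : Fin 2) (c : Fin 3), x = i^a.val * (t3*(i*(t3*t3)))^b.val * t3^c.val := by
  decide +kernel

theorem fin_fact (m : SpecialLinearGroup (Fin 2) (ZMod 3)) (hm : m = t3 ∨ m = t3 * t3) :
   ∃ i : SpecialLinearGroup (Fin 2) (ZMod 3),
   ((i*i)*(i*i)=1 ∧ i * i ≠ 1 ∧ i * (m*(i*(m*m))) = (i*i) *((m*(i*(m*m)))*i)) ∧ (∃ h, i * m * h = (i * i) * (h * m)) ∧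
   ∀ x, ∃ (a : Fin 4) (b : Fin 2) (c : Fin 3), x = i^a.val * (m*(i*(m*m)))^b.val * m^c.val := by
  rcases hm with rfl | rfl
  · exact fin_fact1
  · decide +kernel

theorem three_nil (k : ℕ) (x : ZMod (3^k)) : IsUnit (1 + 3 * x) := by
  apply IsNilpotent.isUnit_one_add
  refine ⟨k, ?_⟩
  rw [mul_pow]
  have : ((3^k : ℕ) : ZMod (3^k)) = 0 := ZMod.natCast_self _
  push_cast at this
  rw [this, zero_mul]

theorem unit_or (k : ℕ) (x : ZMod (3^k)) : IsUnit x ∨ ∃ y, x = 3 * y := by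
  obtain ⟨n, rfl⟩ := ZMod.natCast_zmod_surjective (n := 3^k) x
  by_cases h : 3 ∣ n
  · obtain ⟨y, rfl⟩ := h
    right; exact ⟨y, by push_cast; rfl⟩
  · left
    rw [ZMod.isUnit_iff_coprime]
    exact Nat.Coprime.pow_right k ((Nat.Prime.coprime_iff_not_dvd Nat.prime_three).2 h).symm

theorem hensel (k : ℕ) : ∃ c : ZMod (3^k), 3*c^2 + c + 1 = 0 := by
  have : Function.Injective (fun c : ZMod (3^k) => c + 3*c^2) := by
    intro c d h
    simp only at h
    have h1 : (c - d) * (1 + 3 * (c+d)) = 0 := by linear_combination h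
    have := (three_nil k (c+d)).mul_left_eq_zero.1 h1
    exact sub_eq_zero.1 this
  have hne : NeZero (3^k) := ⟨by positivity⟩
  obtain ⟨c, hc⟩ := (Finite.injective_iff_surjective.1 this) (-1)
  exact ⟨c, by simp only at hc; linear_combination hc⟩

theorem invol (k : ℕ) (Z : Matrix (Fin 2) (Fin 2) (ZMod (3^k))) (h1 : Z * Z = 1) (h2 : Z.det = 1) (h3 : Z ≠ 1) : Z = -1 := by
  have u2 : IsUnit (2 : ZMod (3^k)) := by
    have := three_nil k (-1)
    rw [← IsUnit.neg_iff]
    convert this using 1; ring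
  rw [Matrix.det_fin_two] at h2
  have e00 := congrFun (congrFun h1 0) 0
  have e01 := congrFun (congrFun h1 0) 1
  have e10 := congrFun (congrFun h1 1) 0
  have e11 := congrFun (congrFun h1 1) 1
  simp [Matrix.mul_apply, Fin.sum_univ_two] at e00 e01 e10 e11
  generalize hp : Z 0 0 = p at *
  generalize hq : Z 0 1 = q at *
  generalize hr : Z 1 0 = r at *
  generalize hs : Z 1 1 = s at *
  have ht : p * (p + s) = 2 := by linear_combination e00 + h2
  have ut : IsUnit (p + s) := by
    rw [← ht] at u2; exact isUnit_of_mul_isUnit_right u2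
  have hq0 : q = 0 := ut.mul_left_eq_zero.1 (by linear_combination e01)
  have hr0 : r = 0 := ut.mul_left_eq_zero.1 (by linear_combination e10)
  have hps : p - s = 0 := ut.mul_left_eq_zero.1 (by linear_combination e00 - e11)
  have hpp : p * p = 1 := by rw [hq0] at e00; simpa using e00
  have hsp : s = p := (sub_eq_zero.1 hps).symm
  have key : (p - 1) * (p + 1) = 0 := by linear_combination hpp
  rcases unit_or k (p - 1) with hu | ⟨y, hy⟩
  · have := hu.mul_right_eq_zero.1 key
    have hp1 : p = -1 := by linear_combination this
    ext i j; fin_cases i <;> fin_cases j <;> simp [*]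
  · have hu : IsUnit (p + 1) := by
      rw [← IsUnit.neg_iff]
      convert three_nil k (-(y+1)) using 1
      linear_combination -hy
    have := hu.mul_left_eq_zero.1 key
    have hp1 : p = 1 := by linear_combination this
    exact absurd (by ext i j; fin_cases i <;> fin_cases j <;> simp [*]) h3

theorem word_closed {G : Type*} [Group G] (i j m : G) (hi : i^4 = 1) (hj : j*j = i*i) (hji : j * i = i^3 * j)
    (hmi : m * i = j * m) (hmj : m * j = i * j * m) (hm : m^3 = 1) (x : G) (hx : x ∈ Subgroup.closure {i, m}) :
    ∃ (a : Fin 4) (b : Fin 2) (c : Fin 3), i^a.val * j^b.val * m^c.val = x := by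
  have jT : ∀ a b : ℕ, ∃ a' b' : ℕ, j * (i^a * j^b) = i^a' * j^b' := by
    intro a b
    refine ⟨3*a, b+1, ?_⟩
    have h : SemiconjBy j i (i^3) := hji
    have := (h.pow_right a).eq
    rw [← mul_assoc, this, ← pow_mul, pow_succ', mul_assoc]
  have kT : ∀ a b : ℕ, ∃ a' b' : ℕ, (i * j) * (i^a * j^b) = i^a' * j^b' := by
    intro a b
    obtain ⟨a', b', h⟩ := jT a b
    exact ⟨a'+1, b', by rw [mul_assoc, h, pow_succ', mul_assoc]⟩
  have kpT : ∀ b : ℕ, ∃ a' b' : ℕ, (i * j)^b = i^a' * j^b' := by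
    intro b
    induction b with
    | zero => exact ⟨0, 0, by simp⟩
    | succ n ih =>
      obtain ⟨a, b, h⟩ := ih
      obtain ⟨a', b', h'⟩ := kT a b
      exact ⟨a', b', by rw [pow_succ', h, h']⟩
  have jkT : ∀ a b : ℕ, ∃ a' b' : ℕ, j^a * (i * j)^b = i^a' * j^b' := by
    intro a b
    induction a with
    | zero =>
      obtain ⟨a', b', h⟩ := kpT b
      exact ⟨a', b', by simpa using h⟩
    | succ n ih =>
      obtain ⟨a, b, h⟩ := ih
      obtain ⟨a', b', h'⟩ := jT a b
      exact ⟨a', b', by rw [pow_succ', mul_assoc, h, h']⟩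
  have iS : ∀ x, (∃ a b c : ℕ, i^a * j^b * m^c = x) → ∃ a b c : ℕ, i^a * j^b * m^c = i * x := by
    rintro _ ⟨a, b, c, rfl⟩
    exact ⟨a+1, b, c, by rw [pow_succ']; simp only [mul_assoc]⟩
  have mS : ∀ x, (∃ a b c : ℕ, i^a * j^b * m^c = x) → ∃ a b c : ℕ, i^a * j^b * m^c = m * x := by
    rintro _ ⟨a, b, c, rfl⟩
    obtain ⟨a', b', h⟩ := jkT a b
    refine ⟨a', b', c+1, ?_⟩
    have h1 : SemiconjBy m i j := hmi
    have h2 : SemiconjBy m j (i*j) := hmj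
    have h3 := ((h1.pow_right a).mul_right (h2.pow_right b)).eq
    rw [← mul_assoc m, h3, h, pow_succ']
    simp only [mul_assoc]
  have hi' : i⁻¹ = i * (i * i) := by
    rw [inv_eq_iff_mul_eq_one, ← hi]; simp only [pow_succ, pow_zero, one_mul, mul_assoc]
  have hm' : m⁻¹ = m * m := by
    rw [inv_eq_iff_mul_eq_one, ← hm]; simp only [pow_succ, pow_zero, one_mul, mul_assoc]
  have main : ∃ a b c : ℕ, i^a * j^b * m^c = x := by
    induction hx using Subgroup.closure_induction_left with
    | one => exact ⟨0, 0, 0, by simp⟩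
    | mul_left x hx y hy ih =>
      rcases hx with rfl | rfl
      · exact iS _ ih
      · exact mS _ ih
    | inv_mul_cancel x hx y hy ih =>
      rcases hx with rfl | rfl
      · rw [hi', mul_assoc, mul_assoc]; exact iS _ (iS _ (iS _ ih))
      · rw [hm', mul_assoc]; exact mS _ (mS _ ih)
  obtain ⟨a, b, c, rfl⟩ := main
  refine ⟨⟨(a + 2*(b/2)) % 4, Nat.mod_lt _ (by norm_num)⟩, ⟨b % 2, Nat.mod_lt _ (by norm_num)⟩,
    ⟨c % 3, Nat.mod_lt _ (by norm_num)⟩, ?_⟩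
  simp only
  have e1 : i ^ ((a + 2*(b/2)) % 4) = i^(a + 2*(b/2)) := by
    conv_rhs => rw [← Nat.div_add_mod (a + 2*(b/2)) 4, pow_add, pow_mul, hi, one_pow, one_mul]
  have e3 : m ^ (c % 3) = m^c := by
    conv_rhs => rw [← Nat.div_add_mod c 3, pow_add, pow_mul, hm, one_pow, one_mul]
  have e2 : j^b = i^(2*(b/2)) * j^(b%2) := by
    conv_lhs => rw [← Nat.div_add_mod b 2, pow_add, pow_mul, pow_two, hj, ← pow_two, ← pow_mul]
  rw [e1, e3, e2, pow_add]
  simp only [mul_assoc]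


theorem mat_ext {R : Type*} {a b c d a' b' c' d' : R} (h1 : a = a') (h2 : b = b') (h3 : c = c') (h4 : d = d') :
    !![a, b; c, d] = !![a', b'; c', d'] := by
  rw [h1, h2, h3, h4]

theorem gen3 : ∀ x : SpecialLinearGroup (Fin 2) (ZMod 3), ∃ (a : Fin 4) (b : Fin 2) (c : Fin 3),
    x = s3^a.val * (t3 * s3 * t3^2)^b.val * t3^c.val := by
  decide +kernel

theorem card24 : Nat.card (SpecialLinearGroup (Fin 2) (ZMod 3)) = 24 := by
  rw [Nat.card_eq_fintype_card]; decide +kernel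

theorem exist_part (k : ℕ) (hk : 2 ≤ k) (M : GeneralLinearGroup (Fin 2) (ZMod (3 ^ k)))
    (hM : (M : Matrix (Fin 2) (Fin 2) (ZMod (3 ^ k))) = !![1, -3; 1, -2]) :
    ∃ H : Subgroup (GeneralLinearGroup (Fin 2) (ZMod (3 ^ k))),
        Nonempty (H ≃* SpecialLinearGroup (Fin 2) (ZMod 3)) ∧ M ∈ H := by
  obtain ⟨c, hc⟩ := hensel k
  obtain ⟨i, im⟩ : ∃ i : SpecialLinearGroup (Fin 2) (ZMod (3^k)), i.1 = !![0, 1+3*c; c, 0] := ⟨⟨!![0, 1+3*c; c, 0], by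
    rw [Matrix.det_fin_two_of]; linear_combination -hc⟩, rfl⟩
  obtain ⟨m, mm⟩ : ∃ m : SpecialLinearGroup (Fin 2) (ZMod (3^k)), m.1 = !![1, -3; 1, -2] := ⟨⟨!![1, -3; 1, -2], by
    rw [Matrix.det_fin_two_of]; ring⟩, rfl⟩
  have cm (x y : SpecialLinearGroup (Fin 2) (ZMod (3^k))) : (x * y).1 = x.1 * y.1 := rfl
  have c1 : (1 : SpecialLinearGroup (Fin 2) (ZMod (3^k))).1 = 1 := rfl
  have cn (x : SpecialLinearGroup (Fin 2) (ZMod (3^k))) : (-x).1 = - x.1 := rfl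
  have hii : (i * i : SpecialLinearGroup (Fin 2) (ZMod (3^k))) = -1 := by
    apply Subtype.ext
    have : (-1 : SpecialLinearGroup (Fin 2) (ZMod (3^k))).1 = !![-1, 0; 0, -1] := by
      rw [cn, c1, Matrix.one_fin_two]; simp
    rw [this, cm, im, Matrix.mul_fin_two]
    apply mat_ext <;> first | ring1 | linear_combination hc
  have mm2 : (m^2).1 = !![-2, 3; -1, 1] := by
    rw [pow_two, cm, mm, Matrix.mul_fin_two]
    apply mat_ext <;> ring
  have hm : m^3 = 1 := by
    apply Subtype.ext
    rw [pow_succ, cm, mm2, mm, c1, Matrix.one_fin_two, Matrix.mul_fin_two]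
    apply mat_ext <;> ring
  obtain ⟨j, jdef⟩ : ∃ j, j = m * i * m^2 := ⟨_, rfl⟩
  have hi : i^4 = 1 := by
    have : i^4 = (i*i)*(i*i) := by simp only [pow_succ, pow_zero, one_mul, mul_assoc]
    rw [this, hii]; simp
  have hm2 : m^2 * m = 1 := by rw [← hm]; rfl
  have hj : j * j = i * i := by
    have : j * j = m * (i * ((m^2 * m) * (i * m^2))) := by simp only [jdef, mul_assoc]
    rw [this, hm2, one_mul, ← mul_assoc i, hii]
    rw [neg_mul, one_mul, mul_neg, ← pow_succ', hm]
  have hmi : m * i = j * m := by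
    rw [jdef, mul_assoc _ (m^2), hm2, mul_one]
  have jm : j.1 = !![-1+3*c, 1-6*c; -1+c, 1-3*c] := by
    rw [jdef, cm, cm, im, mm2, mm, Matrix.mul_fin_two, Matrix.mul_fin_two]
    apply mat_ext <;> ring
  have hmj : m * j = i * j * m := by
    apply Subtype.ext
    rw [cm, cm, cm, im, jm, mm]
    simp only [Matrix.mul_fin_two]
    apply mat_ext
    · linear_combination 2 * hc
    · linear_combination (-3) * hc
    · linear_combination hc
    · linear_combination (-1) * hc
  have hji : j * i = i^3 * j := by
    have h3 : i^3 = -i := by rw [pow_succ, pow_two, hii, neg_mul, one_mul]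
    rw [h3]
    apply Subtype.ext
    rw [neg_mul, cm, cn, cm, im, jm]
    simp only [Matrix.mul_fin_two, Matrix.neg_of, Matrix.neg_cons, Matrix.neg_empty]
    apply mat_ext
    · linear_combination (-1) * hc
    · ring
    · ring
    · linear_combination (-1) * hc
  let g := ZMod.castHom (dvd_pow_self 3 (by omega : k ≠ 0)) (ZMod 3)
  let f := SpecialLinearGroup.map (n := Fin 2) g
  have h30 : (3 : ZMod 3) = 0 := by decide
  have hg3 : g 3 = 0 := by rw [map_ofNat, h30]
  have hg2 : - g 2 = 1 := by rw [map_ofNat]; decide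
  have hgc : g c = -1 := by
    have h := congrArg g hc
    simp only [map_add, map_mul, map_pow, map_one, map_zero, map_ofNat, h30] at h
    linear_combination h
  have fi : f i = s3 := by
    apply Subtype.ext
    change i.1.map g = !![0, 1; -1, 0]
    rw [im]
    ext a b; fin_cases a <;> fin_cases b <;> simp [hgc, hg3]
  have fm : f m = t3 := by
    apply Subtype.ext
    change m.1.map g = !![1, 0; 1, 1]
    rw [mm]
    ext a b; fin_cases a <;> fin_cases b <;> simp [hg2, hg3]
  let H := Subgroup.closure {i, m}
  have hiH : i ∈ H := Subgroup.subset_closure (by simp)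
  have hmH : m ∈ H := Subgroup.subset_closure (by simp)
  have hjH : j ∈ H := by
    rw [jdef]; exact H.mul_mem (H.mul_mem hmH hiH) (H.pow_mem hmH 2)
  have hsurj : Function.Surjective (f.comp H.subtype) := by
    intro x
    obtain ⟨a, b, c, rfl⟩ := gen3 x
    refine ⟨⟨i^a.val * j^b.val * m^c.val, H.mul_mem (H.mul_mem (H.pow_mem hiH _) (H.pow_mem hjH _)) (H.pow_mem hmH _)⟩, ?_⟩
    simp [jdef, fi, fm]
  let w : Fin 4 × Fin 2 × Fin 3 → H := fun p => ⟨i^p.1.val * j^p.2.1.val * m^p.2.2.val,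
    H.mul_mem (H.mul_mem (H.pow_mem hiH _) (H.pow_mem hjH _)) (H.pow_mem hmH _)⟩
  have wsurj : Function.Surjective w := by
    rintro ⟨x, hx⟩
    obtain ⟨a, b, c, h⟩ := word_closed i j m hi hj hji hmi hmj hm x hx
    exact ⟨(a, b, c), Subtype.ext h⟩
  have hfin : Finite H := Finite.of_surjective w wsurj
  have hcard : Nat.card H ≤ Nat.card (SpecialLinearGroup (Fin 2) (ZMod 3)) := by
    rw [card24]
    refine (Nat.card_le_card_of_surjective w wsurj).trans ?_
    simp
  have hbij : Function.Bijective (f.comp H.subtype) := hsurj.bijective_of_nat_card_le hcard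
  have hinj : Function.Injective (SpecialLinearGroup.toGL (n := Fin 2) (R := ZMod (3^k))) := by
    intro x y h
    apply Subtype.ext
    exact congrArg Units.val h
  refine ⟨H.map SpecialLinearGroup.toGL, ⟨(H.equivMapOfInjective _ hinj).symm.trans (MulEquiv.ofBijective _ hbij)⟩, ?_⟩
  refine ⟨m, hmH, ?_⟩
  apply Units.ext
  rw [hM, ← mm]
  rfl

theorem extract (k : ℕ) (M : GeneralLinearGroup (Fin 2) (ZMod (3 ^ k)))
    (hM : (M : Matrix (Fin 2) (Fin 2) (ZMod (3 ^ k))) = !![1, -3; 1, -2])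
    (H : Subgroup (GeneralLinearGroup (Fin 2) (ZMod (3 ^ k))))
    (e : H ≃* SpecialLinearGroup (Fin 2) (ZMod 3)) (hMH : M ∈ H) (hk : 2 ≤ k) :
    ∃ (I : GeneralLinearGroup (Fin 2) (ZMod (3 ^ k))) (a c : ZMod (3^k)),
      H = Subgroup.closure {I, M} ∧ I.1 = !![a, 1 - 3*a + 3*c; c, -a] ∧
      a^2 + c - 3*a*c + 3*c^2 + 1 = 0 := by
  have u2 : IsUnit (2 : ZMod (3^k)) := by
    have := three_nil k (-1)
    rw [← IsUnit.neg_iff]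
    convert this using 1; ring
  have hM3 : M * (M * M) = 1 := by
    apply Units.ext
    rw [Units.val_mul, Units.val_mul, hM, Units.val_one, Matrix.one_fin_two]
    simp only [Matrix.mul_fin_two]
    apply mat_ext <;> ring
  have hM1 : M ≠ 1 := by
    intro h
    rw [h] at hM
    have := congrFun (congrFun hM 1) 0
    have hnt : Nontrivial (ZMod (3^k)) := by
      have : Fact (1 < 3^k) := ⟨Nat.one_lt_pow (by omega) (by norm_num)⟩
      infer_instance
    simp at this
  obtain ⟨h0, hh0⟩ := conj_fact (e ⟨M, hMH⟩)
    (by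
      rw [← map_mul, ← map_mul, ← map_one e]
      exact congrArg e (Subtype.ext hM3))
    (by
      rw [← map_one e]
      intro h
      exact hM1 (congrArg Subtype.val (e.injective h)))
  obtain ⟨e', he'⟩ : ∃ e' : H ≃* SpecialLinearGroup (Fin 2) (ZMod 3),
      e' ⟨M, hMH⟩ = t3 ∨ e' ⟨M, hMH⟩ = t3 * t3 := by
    refine ⟨e.trans (MulAut.conj h0⁻¹), ?_⟩
    simp only [MulEquiv.trans_apply, MulAut.conj_apply, inv_inv, mul_assoc]
    rcases hh0 with h | h
    · left; rw [h, inv_mul_cancel_left]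
    · right; rw [h, inv_mul_cancel_left]
  clear hh0
  clear e
  rename' e' => e
  have emap (x y : H) : e x = e y → x.1 = y.1 := fun h => congrArg Subtype.val (e.injective h)
  obtain ⟨i, ⟨h4, h2, hcomm⟩, ⟨h, hh⟩, hgen⟩ := fin_fact (e ⟨M, hMH⟩) he'
  obtain ⟨⟨I, hI⟩, rfl⟩ := e.surjective i
  obtain ⟨⟨L, hL⟩, rfl⟩ := e.surjective h
  simp only [← map_mul] at h4 h2 hcomm hh
  rw [← map_one e] at h4 h2
  replace h4 : I * I * (I * I) = 1 := emap _ _ h4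
  replace h2 : I * I ≠ 1 := by
    intro h; exact h2 (congrArg e (Subtype.ext h))
  replace hcomm : I * (M * (I * (M * M))) = (I * I) * ((M * (I * (M * M))) * I) := emap _ _ hcomm
  replace hh : I * M * L = (I * I) * (L * M) := emap _ _ hh
  have hcl : H = Subgroup.closure {I, M} := by
    apply le_antisymm
    · intro x hx
      obtain ⟨a, b, c, hw⟩ := hgen (e ⟨x, hx⟩)
      simp only [← map_mul, ← map_pow] at hw
      replace hw : x = I^a.val * (M * (I * (M * M)))^b.val * M^c.val := emap _ _ hw
      have h1 : I ∈ Subgroup.closure {I, M} := Subgroup.subset_closure (by simp)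
      have h2 : M ∈ Subgroup.closure {I, M} := Subgroup.subset_closure (by simp)
      rw [hw]
      exact mul_mem (mul_mem (pow_mem h1 _) (pow_mem (mul_mem h2 (mul_mem h1 (mul_mem h2 h2))) _)) (pow_mem h2 _)
    · rw [Subgroup.closure_le]
      rintro x (rfl | rfl)
      · exact hI
      · exact hMH
  have hz : (I.1 * I.1) = -1 := by
    have hd : (I * I).1.det = 1 := by
      have := congrArg Matrix.GeneralLinearGroup.det hcomm
      simp only [map_mul] at this
      have h1 : Matrix.GeneralLinearGroup.det I * Matrix.GeneralLinearGroup.det I = 1 := by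
        rw [mul_comm, eq_comm] at this
        generalize Matrix.GeneralLinearGroup.det I = u at *
        generalize Matrix.GeneralLinearGroup.det M = v at *
        have h' : (u * u) * (v * (u * (v * v)) * u) = 1 * (v * (u * (v * v)) * u) := by
          rw [this, one_mul]
        exact mul_right_cancel h'
      have := congrArg Units.val h1
      simpa using this
    apply invol k (I * I).1 _ hd
    · intro h; exact h2 (Units.ext h)
    · exact congrArg Units.val h4
  -- trace of `I` vanishes
  have htr : I.1.trace = 0 := by
    have hJ : ∃ J : GeneralLinearGroup (Fin 2) (ZMod (3^k)), I.1 * J.1 = - (J.1 * I.1) := by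
      refine ⟨M * (I * (M * M)), ?_⟩
      have := congrArg Units.val hcomm
      rw [Units.val_mul, Units.val_mul _ (_ * I), Units.val_mul I I, hz, Units.val_mul _ I] at this
      rw [this, neg_mul, one_mul]
    obtain ⟨J, hJ⟩ := hJ
    have h1 : I.1 = - (J.1 * I.1 * J⁻¹.1) := by
      rw [← neg_mul, ← hJ, mul_assoc, Units.mul_inv, mul_one]
    have h3 : I.1.trace = - I.1.trace := by
      conv_lhs => rw [h1, Matrix.trace_neg, Matrix.trace_mul_comm, ← mul_assoc, Units.inv_mul, one_mul]
    exact u2.mul_right_eq_zero.1 (by linear_combination h3)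
  have htr2 : (I.1 * M.1).trace = 1 := by
    have h1 : I.1 * M.1 = - (L.1 * M.1 * L⁻¹.1) := by
      have := congrArg Units.val hh
      rw [Units.val_mul, Units.val_mul, Units.val_mul (I * I), Units.val_mul, Units.val_mul, hz] at this
      rw [← neg_mul, ← one_mul (L.1 * M.1), ← neg_mul, ← this, mul_assoc, Units.mul_inv, mul_one]
    rw [h1, Matrix.trace_neg, Matrix.trace_mul_comm, ← mul_assoc, Units.inv_mul, one_mul, hM,
      Matrix.trace_fin_two_of]
    ring
  have eI := Matrix.eta_fin_two I.1
  generalize I.1 0 0 = a at eI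
  generalize I.1 0 1 = b at eI
  generalize I.1 1 0 = c at eI
  generalize I.1 1 1 = d at eI
  rw [eI, Matrix.trace_fin_two_of] at htr
  rw [eI, hM, Matrix.mul_fin_two, Matrix.trace_fin_two_of] at htr2
  rw [eI, Matrix.mul_fin_two, Matrix.one_fin_two] at hz
  have e00 := congrFun (congrFun hz 0) 0
  simp at e00
  have hd : d = -a := by linear_combination htr
  have hb : b = 1 - 3*a + 3*c := by rw [hd] at htr2; linear_combination htr2
  refine ⟨I, a, c, hcl, ?_, ?_⟩
  · rw [eI, hd, hb]
  · rw [hb] at e00; linear_combination e00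

theorem conj_part (k : ℕ) (M I J : GeneralLinearGroup (Fin 2) (ZMod (3 ^ k)))
    (hM : (M : Matrix (Fin 2) (Fin 2) (ZMod (3 ^ k))) = !![1, -3; 1, -2])
    (a c a' c' : ZMod (3^k)) (hI : I.1 = !![a, 1 - 3*a + 3*c; c, -a]) (h : a^2 + c - 3*a*c + 3*c^2 + 1 = 0)
    (hJ : J.1 = !![a', 1 - 3*a' + 3*c'; c', -a']) (h' : a'^2 + c' - 3*a'*c' + 3*c'^2 + 1 = 0) :
    ∃ g : GeneralLinearGroup (Fin 2) (ZMod (3 ^ k)), g * I * g⁻¹ = J ∧ g * M * g⁻¹ = M := by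
  obtain ⟨x, hx⟩ : ∃ x, x = 1 - 2*a' - a + 3*(c + c') := ⟨_, rfl⟩
  obtain ⟨y, hy⟩ : ∃ y, y = a - a' := ⟨_, rfl⟩
  have hu : IsUnit (!![x + y, -3*y; y, x - 2*y]).det := by
    rw [Matrix.det_fin_two_of]
    have h1 := three_nil k (-a' + c + c')
    have h2 := three_nil k (2 * (-a' + c + c') + 3 * (-a' + c + c')^2 - x*y)
    convert h2 using 1
    rw [hx, hy]; ring
  let g := Matrix.GeneralLinearGroup.mk'' _ hu
  have hg : g.1 = !![x + y, -3*y; y, x - 2*y] := rfl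
  refine ⟨g, ?_, ?_⟩
  · rw [mul_inv_eq_iff_eq_mul]
    apply Units.ext
    rw [Units.val_mul, Units.val_mul, hg, hI, hJ, Matrix.mul_fin_two, Matrix.mul_fin_two, hx, hy]
    apply mat_ext
    · ring
    · linear_combination 3 * h - 3 * h'
    · linear_combination h - h'
    · ring
  · rw [mul_inv_eq_iff_eq_mul]
    apply Units.ext
    rw [Units.val_mul, Units.val_mul, hg, hM, Matrix.mul_fin_two, Matrix.mul_fin_two]
    apply mat_ext <;> ring

end Sl2Lift

/-- For `k ≥ 2` there is a subgroup of `GL₂(ℤ/3ᵏ)` isomorphic to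
`SL₂(𝔽₃)` containing the matrix `[[1,-3],[1,-2]]`, and any two such subgroups
are conjugate in `GL₂(ℤ/3ᵏ)`. -/
theorem sl2_lift_exists_unique_gamma0 (k : ℕ) (hk : 2 ≤ k)
    (M : Matrix.GeneralLinearGroup (Fin 2) (ZMod (3 ^ k)))
    (hM : (M : Matrix (Fin 2) (Fin 2) (ZMod (3 ^ k))) = !![1, -3; 1, -2]) :
    (∃ H : Subgroup (Matrix.GeneralLinearGroup (Fin 2) (ZMod (3 ^ k))),
        Nonempty (H ≃* Matrix.SpecialLinearGroup (Fin 2) (ZMod 3)) ∧ M ∈ H) ∧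
    ∀ H₁ H₂ : Subgroup (Matrix.GeneralLinearGroup (Fin 2) (ZMod (3 ^ k))),
      Nonempty (H₁ ≃* Matrix.SpecialLinearGroup (Fin 2) (ZMod 3)) → M ∈ H₁ →
      Nonempty (H₂ ≃* Matrix.SpecialLinearGroup (Fin 2) (ZMod 3)) → M ∈ H₂ →
      ∃ g : Matrix.GeneralLinearGroup (Fin 2) (ZMod (3 ^ k)),
        Subgroup.map (MulAut.conj g).toMonoidHom H₁ = H₂ := by
  refine ⟨Sl2Lift.exist_part k hk M hM, ?_⟩
  rintro H₁ H₂ ⟨e₁⟩ h₁ ⟨e₂⟩ h₂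
  obtain ⟨I, a, c, hI1, hI2, hI3⟩ := Sl2Lift.extract k M hM H₁ e₁ h₁ hk
  obtain ⟨J, a', c', hJ1, hJ2, hJ3⟩ := Sl2Lift.extract k M hM H₂ e₂ h₂ hk
  obtain ⟨g, hg1, hg2⟩ := Sl2Lift.conj_part k M I J hM a c a' c' hI2 hI3 hJ2 hJ3
  refine ⟨g, ?_⟩
  rw [hI1, hJ1, MonoidHom.map_closure, Set.image_pair]
  have e1 : (MulAut.conj g).toMonoidHom I = J := hg1
  have e2 : (MulAut.conj g).toMonoidHom M = M := hg2
  rw [e1, e2]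
end

section
/- Let k ≥ 2 be an integer. There exists a subgroup H of GL₂(ℤ/3ᵏ) that is isomorphic (as an abstract group) to GL₂(𝔽₃) and contains the matrix [[1,-3],[1,-2]]. Moreover, any two subgroups of GL₂(ℤ/3ᵏ) that are isomorphic to GL₂(𝔽₃) and contain the matrix [[1,-3],[1,-2]] are conjugate in GL₂(ℤ/3ᵏ). -/
set_option linter.unusedSimpArgs false

namespace GL2Lift

open Matrix

abbrev G (R : Type) [CommRing R] := Matrix.GeneralLinearGroup (Fin 2) R

section
variable {R : Type} [CommRing R] (f : R →+* ZMod 3)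

/-- reduction -/
abbrev red : G R →* G (ZMod 3) := Matrix.GeneralLinearGroup.map f

theorem red_coe (A : G R) : ((red f A : G (ZMod 3)) : Matrix (Fin 2) (Fin 2) (ZMod 3)) =
    f.mapMatrix (A : Matrix (Fin 2) (Fin 2) R) := rfl

theorem pow8 (hf : ∀ u : R, f u ≠ 0 → IsUnit u) (A : G R) (h1 : red f A = 1) (h8 : A ^ 8 = 1) :
    A = 1 := by
  obtain ⟨B, hB⟩ : ∃ B : Matrix (Fin 2) (Fin 2) R, B = A.val := ⟨_, rfl⟩
  have hB8 : B ^ 8 = 1 := by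
    rw [hB, ← Units.val_pow_eq_pow_val, h8]; rfl
  have hm : f.mapMatrix B = 1 := by
    rw [hB, ← red_coe, h1]; rfl
  have hs : (B - 1) * (∑ i ∈ Finset.range 8, B ^ i) = 0 := by
    rw [mul_geom_sum, hB8, sub_self]
  have hu : IsUnit (∑ i ∈ Finset.range 8, B ^ i) := by
    rw [Matrix.isUnit_iff_isUnit_det]
    apply hf
    rw [RingHom.map_det, map_sum]
    simp only [map_pow, hm, one_pow, Finset.sum_const, Finset.card_range]
    decide
  have h0 : B - 1 = 0 := by
    obtain ⟨u, hu⟩ := hu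
    rw [← hu] at hs
    simpa using hs
  apply Units.ext
  rw [← hB, Units.val_one]
  exact sub_eq_zero.mp h0

theorem scal (hf : ∀ u : R, f u ≠ 0 → IsUnit u) (A I J : Matrix (Fin 2) (Fin 2) R)
    (hI : f.mapMatrix I = !![1,-1;-1,-1]) (hJ : f.mapMatrix J = !![-1,-1;-1,1])
    (cI : A * I = I * A) (cJ : A * J = J * A) : A = (A 0 0) • (1 : Matrix (Fin 2) (Fin 2) R) := by
  have i00 := congrFun (congrFun hI 0) 0
  have i01 := congrFun (congrFun hI 0) 1
  have i11 := congrFun (congrFun hI 1) 1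
  have j00 := congrFun (congrFun hJ 0) 0
  have j01 := congrFun (congrFun hJ 0) 1
  have j11 := congrFun (congrFun hJ 1) 1
  have a00 := congrFun (congrFun cI 0) 0
  have a01 := congrFun (congrFun cI 0) 1
  have b01 := congrFun (congrFun cJ 0) 1
  simp [Matrix.mul_apply, Fin.sum_univ_two] at i00 i01 i11 j00 j01 j11 a00 a01 b01
  have uy : IsUnit (I 0 1) := hf _ (by rw [i01]; decide)
  have uu : IsUnit ((I 0 0 - I 1 1) * J 0 1 - (J 0 0 - J 1 1) * I 0 1) := hf _ (by
    simp only [map_sub, map_mul, i00, i01, i11, j00, j01, j11]; decide)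
  have q0 : A 0 1 = 0 := by
    apply (uu.mul_left_eq_zero).1
    linear_combination (I 0 1) * b01 - (J 0 1) * a01
  have r0 : A 1 0 = 0 := by
    apply (uy.mul_left_eq_zero).1
    rw [q0] at a00
    linear_combination -a00
  have t0 : A 0 0 - A 1 1 = 0 := by
    apply (uy.mul_left_eq_zero).1
    rw [q0] at a01
    linear_combination a01
  ext i j
  fin_cases i <;> fin_cases j <;> simp [q0, r0]
  linear_combination -t0

end

theorem avg {S : Type*} [Ring S] (A B a b : S) (hA : A * A = -1) (hB : B * B = -1)
    (hAB : A * B = -(B * A)) (ha : a * a = -1) (hb : b * b = -1) (hab : a * b = -(b * a)) :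
    A * (1 - A * a - B * b + A * B * b * a) = (1 - A * a - B * b + A * B * b * a) * a ∧
    B * (1 - A * a - B * b + A * B * b * a) = (1 - A * a - B * b + A * B * b * a) * b := by
  have hA' : ∀ x, A * (A * x) = -x := fun x => by rw [← mul_assoc, hA, neg_one_mul]
  have hB' : ∀ x, B * (B * x) = -x := fun x => by rw [← mul_assoc, hB, neg_one_mul]
  have ha' : ∀ x, a * (a * x) = -x := fun x => by rw [← mul_assoc, ha, neg_one_mul]
  have hb' : ∀ x, b * (b * x) = -x := fun x => by rw [← mul_assoc, hb, neg_one_mul]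
  have hAB' : ∀ x, A * (B * x) = -(B * (A * x)) := fun x => by
    rw [← mul_assoc, hAB, neg_mul, mul_assoc]
  have hab' : ∀ x, a * (b * x) = -(b * (a * x)) := fun x => by
    rw [← mul_assoc, hab, neg_mul, mul_assoc]
  constructor
  · simp only [mul_add, add_mul, mul_sub, sub_mul, mul_assoc, hA, hB, hAB, ha, hb, hab, hA', hB',
      hAB', ha', hb', hab', mul_neg, neg_mul, neg_neg, mul_one, one_mul]
    abel
  · simp only [mul_add, add_mul, mul_sub, sub_mul, mul_assoc, hA, hB, hAB, ha, hb, hab, hA', hB',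
      hAB', ha', hb', hab', mul_neg, neg_mul, neg_neg, mul_one, one_mul]
    abel

theorem henselZ (k : ℕ) : ∃ c : ℤ, (3:ℤ) ^ k ∣ 3 * c ^ 2 - 4 * c + 2 := by
  induction k with
  | zero => exact ⟨0, by simp⟩
  | succ k ih =>
    obtain ⟨c, m, hm⟩ := ih
    refine ⟨c + 3 ^ k * m, m * (2 * c - 1) + 3 ^ k * m ^ 2, ?_⟩
    rw [pow_succ]
    linear_combination hm

theorem unit_of_cast (k : ℕ) (h : 3 ∣ 3 ^ k) (u : ZMod (3 ^ k))
    (hu : ZMod.castHom h (ZMod 3) u ≠ 0) : IsUnit u := by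
  have : NeZero (3 ^ k) := ⟨by positivity⟩
  rw [← ZMod.natCast_zmod_val u] at hu ⊢
  rw [ZMod.isUnit_iff_coprime]
  rw [map_natCast, Ne, ZMod.natCast_eq_zero_iff] at hu
  exact (((Nat.prime_three).coprime_iff_not_dvd.2 hu).symm).pow_right k
theorem F1 : ∀ a b c d : ZMod 3, a*d-b*c ≠ 0 → !![a,b;c,d] ^24 = 1 := by decide +kernel
theorem F2 : ∀ a b c d : ZMod 3, !![a,b;c,d] ^3 = 1 → !![a,b;c,d] ≠ 1 →
   ((!![a,b;c,d] * (!![0,1;1,0] * !![a,b;c,d] * !![0,1;1,0]))^8 = 1 ∧ (!![a,b;c,d] * (!![0,1;1,0] * !![a,b;c,d] * !![0,1;1,0])) ≠ 1) ∨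
   ((!![a,b;c,d] * (!![1,0;0,-1] * !![a,b;c,d] * !![1,0;0,-1]))^8 = 1 ∧ (!![a,b;c,d] * (!![1,0;0,-1] * !![a,b;c,d] * !![1,0;0,-1])) ≠ 1)  := by decide +kernel
theorem F3 : ∀ a b c d : ZMod 3, a*d-b*c ≠ 0 → !![a,b;c,d] ^8 = 1 ∨ (!![1,0;0,-1] * !![a,b;c,d])^8 = 1 := by decide +kernel
theorem F4i : ∀ a b c d : ZMod 3, a*d-b*c ≠ 0 → ∃ m n : Fin 4,
   !![1,-1;-1,-1] * !![a,b;c,d] = !![a,b;c,d] * (!![1,-1;-1,-1] ^m.1 * !![-1,-1;-1,1] ^n.1) := by decide +kernel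
theorem F4j : ∀ a b c d : ZMod 3, a*d-b*c ≠ 0 → ∃ m n : Fin 4,
   !![-1,-1;-1,1] * !![a,b;c,d] = !![a,b;c,d] * (!![1,-1;-1,-1] ^m.1 * !![-1,-1;-1,1] ^n.1) := by decide +kernel
theorem F5 : ∀ a b c d : ZMod 3, a*d-b*c ≠ 0 → ∃ m : Fin 3, ∃ n : Fin 4, ∃ p q : Fin 2,
   !![a,b;c,d] = !![1,0;1,1] ^m.1 * !![1,-1;-1,-1] ^n.1 * !![-1,-1;-1,1] ^p.1 * !![0,1;1,0] ^q.1 := by decide +kernel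

/-- generators of the quaternion group -/
def i0 : G (ZMod 3) := ⟨!![1,-1;-1,-1], -!![1,-1;-1,-1], by decide, by decide⟩
/-- generators of the quaternion group -/
def j0 : G (ZMod 3) := ⟨!![-1,-1;-1,1], -!![-1,-1;-1,1], by decide, by decide⟩
/-- a reflection -/
def d0 : G (ZMod 3) := ⟨!![1,0;0,-1], !![1,0;0,-1], by decide, by decide⟩
/-- a reflection -/
def w0 : G (ZMod 3) := ⟨!![0,1;1,0], !![0,1;1,0], by decide, by decide⟩

theorem entries (x : G (ZMod 3)) : ∃ a b c d : ZMod 3, a * d - b * c ≠ 0 ∧ x.val = !![a,b;c,d] := by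
  refine ⟨x.val 0 0, x.val 0 1, x.val 1 0, x.val 1 1, ?_, Matrix.eta_fin_two _⟩
  rw [← Matrix.det_fin_two]
  exact ((Matrix.isUnit_iff_isUnit_det _).1 x.isUnit).ne_zero

theorem g1 (x : G (ZMod 3)) : x ^ 24 = 1 := by
  obtain ⟨a, b, c, d, h, hx⟩ := entries x
  apply Units.ext
  rw [Units.val_pow_eq_pow_val, hx]
  exact F1 a b c d h

theorem g2 (x : G (ZMod 3)) (h3 : x ^ 3 = 1) (h1 : x ≠ 1) :
    ∃ g : G (ZMod 3), (x * (g * x * g⁻¹)) ^ 8 = 1 ∧ x * (g * x * g⁻¹) ≠ 1 := by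
  obtain ⟨a, b, c, d, h, hx⟩ := entries x
  have h3' : x.val ^ 3 = 1 := by rw [← Units.val_pow_eq_pow_val, h3]; rfl
  have h1' : x.val ≠ 1 := fun h => h1 (Units.ext h)
  rw [hx] at h3' h1'
  rcases F2 a b c d h3' h1' with ⟨p, q⟩ | ⟨p, q⟩
  · refine ⟨w0, ?_, ?_⟩
    · apply Units.ext
      rw [Units.val_pow_eq_pow_val, Units.val_mul, Units.val_mul, Units.val_mul, hx]
      exact p
    · intro hh
      apply q
      have := congrArg Units.val hh
      rw [Units.val_mul, Units.val_mul, Units.val_mul, hx] at this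
      exact this
  · refine ⟨d0, ?_, ?_⟩
    · apply Units.ext
      rw [Units.val_pow_eq_pow_val, Units.val_mul, Units.val_mul, Units.val_mul, hx]
      exact p
    · intro hh
      apply q
      have := congrArg Units.val hh
      rw [Units.val_mul, Units.val_mul, Units.val_mul, hx] at this
      exact this

theorem g3 (x : G (ZMod 3)) : x ^ 8 = 1 ∨ (d0 * x) ^ 8 = 1 := by
  obtain ⟨a, b, c, d, h, hx⟩ := entries x
  rcases F3 a b c d h with p | p
  · left
    apply Units.ext
    rw [Units.val_pow_eq_pow_val, hx]; exact p
  · right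
    apply Units.ext
    rw [Units.val_pow_eq_pow_val, Units.val_mul, hx]; exact p

theorem g4i (x : G (ZMod 3)) : ∃ m n : ℕ, i0 * x = x * (i0 ^ m * j0 ^ n) := by
  obtain ⟨a, b, c, d, h, hx⟩ := entries x
  obtain ⟨m, n, p⟩ := F4i a b c d h
  refine ⟨m, n, Units.ext ?_⟩
  simp only [Units.val_mul, Units.val_pow_eq_pow_val, hx]
  exact p

theorem g4j (x : G (ZMod 3)) : ∃ m n : ℕ, j0 * x = x * (i0 ^ m * j0 ^ n) := by
  obtain ⟨a, b, c, d, h, hx⟩ := entries x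
  obtain ⟨m, n, p⟩ := F4j a b c d h
  refine ⟨m, n, Units.ext ?_⟩
  simp only [Units.val_mul, Units.val_pow_eq_pow_val, hx]
  exact p

section
variable {R : Type} [CommRing R] (f : R →+* ZMod 3)

theorem red_neg (A : G R) : red f (-A) = -red f A := by
  apply Units.ext
  rw [red_coe, Units.val_neg, Units.val_neg, map_neg, red_coe]

theorem sec_neg (hf : ∀ u : R, f u ≠ 0 → IsUnit u) (σ : G (ZMod 3) →* G R)
    (hσ : ∀ x, red f (σ x) = x) : σ (-1) = -1 := by
  have : -σ (-1) = 1 := by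
    apply pow8 f hf
    · rw [red_neg, hσ, neg_neg]
    · rw [Even.neg_pow (by decide), ← map_pow, Even.neg_pow (by decide), one_pow, map_one]
  rw [← this, neg_neg]

theorem sec_rel (hf : ∀ u : R, f u ≠ 0 → IsUnit u) (σ : G (ZMod 3) →* G R)
    (hσ : ∀ x, red f (σ x) = x) : (σ i0).val * (σ i0).val = -1 ∧ (σ j0).val * (σ j0).val = -1 ∧
      (σ i0).val * (σ j0).val = -((σ j0).val * (σ i0).val) := by
  have hn := sec_neg f hf σ hσ
  have e1 : i0 * i0 = -1 := by apply Units.ext; decide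
  have e2 : j0 * j0 = -1 := by apply Units.ext; decide
  have e3 : i0 * j0 = -1 * (j0 * i0) := by apply Units.ext; decide
  have s1 : σ i0 * σ i0 = -1 := by rw [← map_mul, e1, hn]
  have s2 : σ j0 * σ j0 = -1 := by rw [← map_mul, e2, hn]
  have s3 : σ i0 * σ j0 = -(σ j0 * σ i0) := by rw [← map_mul, e3, map_mul, hn, map_mul, neg_one_mul]
  exact ⟨congrArg Units.val s1, congrArg Units.val s2, congrArg Units.val s3⟩

/-- sections agreeing on the quaternion group agree -/
theorem sec_eq (hf : ∀ u : R, f u ≠ 0 → IsUnit u) (σ τ : G (ZMod 3) →* G R)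
    (hσ : ∀ x, red f (σ x) = x) (hτ : ∀ x, red f (τ x) = x)
    (hi : σ i0 = τ i0) (hj : σ j0 = τ j0) : ∀ x, σ x = τ x := by
  have key : ∀ x, x ^ 8 = 1 → σ x = τ x := by
    intro x hx
    have hc : ∀ y, (∃ m n : ℕ, y * x = x * (i0 ^ m * j0 ^ n)) → σ y = τ y →
        Commute (τ x * (σ x)⁻¹) (τ y) := by
      rintro y ⟨m, n, hy⟩ hyy
      have h1 := congrArg σ hy
      have h2 := congrArg τ hy
      simp only [map_mul, map_pow, hi, hj, hyy] at h1 h2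
      have h3 : (σ x)⁻¹ * τ y = (τ i0 ^ m * τ j0 ^ n) * (σ x)⁻¹ := by
        rw [inv_mul_eq_iff_eq_mul, ← mul_assoc, eq_mul_inv_iff_mul_eq, h1]
      change τ x * (σ x)⁻¹ * τ y = τ y * (τ x * (σ x)⁻¹)
      rw [mul_assoc, h3, ← mul_assoc, ← h2, mul_assoc]
    have ci := hc i0 (g4i x) hi
    have cj := hc j0 (g4j x) hj
    have hs := scal f hf (τ x * (σ x)⁻¹ : G R).val (τ i0).val (τ j0).val
      (by rw [← red_coe, hτ]; rfl) (by rw [← red_coe, hτ]; rfl)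
      (congrArg Units.val ci) (congrArg Units.val cj)
    have hcc : Commute (τ x * (σ x)⁻¹) (σ x) := by
      apply Units.ext
      change (τ x * (σ x)⁻¹ : G R).val * (σ x).val = (σ x).val * (τ x * (σ x)⁻¹ : G R).val
      rw [hs]
      simp
    have h1 : τ x * (σ x)⁻¹ = 1 := by
      apply pow8 f hf
      · rw [map_mul, map_inv, hσ, hτ, mul_inv_cancel]
      · have : (τ x * (σ x)⁻¹ * σ x) ^ 8 = (τ x * (σ x)⁻¹) ^ 8 * (σ x) ^ 8 := hcc.mul_pow 8
        rw [inv_mul_cancel_right, ← map_pow, ← map_pow, hx, map_one, map_one, mul_one] at this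
        exact this.symm
    exact (mul_inv_eq_one.1 h1).symm
  intro x
  rcases g3 x with h | h
  · exact key x h
  · have h1 := key _ h
    have h2 : σ d0 = τ d0 := key d0 (by apply Units.ext; decide)
    rw [map_mul, map_mul, h2] at h1
    exact mul_left_cancel h1

theorem sec_conj (hf : ∀ u : R, f u ≠ 0 → IsUnit u) (σ τ : G (ZMod 3) →* G R)
    (hσ : ∀ x, red f (σ x) = x) (hτ : ∀ x, red f (τ x) = x) :
    ∃ g : G R, ∀ x, g * σ x * g⁻¹ = τ x := by
  obtain ⟨a1, a2, a3⟩ := sec_rel f hf σ hσ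
  obtain ⟨b1, b2, b3⟩ := sec_rel f hf τ hτ
  obtain ⟨t1, t2⟩ := avg _ _ _ _ b1 b2 b3 a1 a2 a3
  set T := 1 - (τ i0).val * (σ i0).val - (τ j0).val * (σ j0).val +
    (τ i0).val * (τ j0).val * (σ j0).val * (σ i0).val with hT
  have hTm : f.mapMatrix T = 1 := by
    rw [hT]
    simp only [map_sub, map_add, map_mul, map_one]
    rw [← red_coe, ← red_coe, ← red_coe, ← red_coe, hσ, hτ, hσ, hτ]
    decide
  have hTu : IsUnit T := by
    rw [Matrix.isUnit_iff_isUnit_det]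
    apply hf
    rw [RingHom.map_det, hTm]
    simp
  obtain ⟨g, hg⟩ := hTu
  have hgm : red f g = 1 := by
    apply Units.ext
    rw [red_coe, hg, hTm]; rfl
  rw [← hg] at t1 t2
  refine ⟨g, ?_⟩
  apply sec_eq f hf ((MulAut.conj g).toMonoidHom.comp σ) τ _ hτ
  · change g * σ i0 * g⁻¹ = τ i0
    rw [mul_inv_eq_iff_eq_mul]
    exact Units.ext t1.symm
  · change g * σ j0 * g⁻¹ = τ j0
    rw [mul_inv_eq_iff_eq_mul]
    exact Units.ext t2.symm
  · intro x
    change red f (g * σ x * g⁻¹) = x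
    rw [map_mul, map_mul, map_inv, hgm, hσ]
    simp

/-- subgroups isomorphic to GL2(F3) come from sections -/
theorem exists_sec (hf : ∀ u : R, f u ≠ 0 → IsUnit u) (H : Subgroup (G R))
    (φ : H ≃* G (ZMod 3)) : ∃ σ : G (ZMod 3) →* G R, (∀ x, red f (σ x) = x) ∧ σ.range = H := by
  let ψ : G (ZMod 3) →* G R := H.subtype.comp φ.symm.toMonoidHom
  have hψ : Function.Injective ψ := H.subtype_injective.comp φ.symm.injective
  have key : ∀ x, red f (ψ x) = 1 → x ^ 8 = 1 → x = 1 := by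
    intro x h1 h8
    apply hψ
    rw [map_one]
    apply pow8 f hf _ h1
    rw [← map_pow, h8, map_one]
  have hinj : Function.Injective ((red f).comp ψ) := by
    rw [injective_iff_map_eq_one]
    intro x hx
    change red f (ψ x) = 1 at hx
    have h3 : x ^ 3 = 1 := by
      apply key
      · rw [map_pow, map_pow, hx, one_pow]
      · rw [← pow_mul]; exact g1 x
    by_contra hne
    obtain ⟨g, p, q⟩ := g2 x h3 hne
    apply q
    apply key _ _ p
    simp only [map_mul, map_inv, hx]
    simp
  have hbij := Finite.injective_iff_bijective.1 hinj
  let e := MulEquiv.ofBijective _ hbij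
  refine ⟨ψ.comp e.symm.toMonoidHom, fun x => e.apply_symm_apply x, ?_⟩
  ext y
  constructor
  · rintro ⟨x, rfl⟩
    exact (φ.symm (e.symm x)).2
  · intro hy
    refine ⟨e (φ ⟨y, hy⟩), ?_⟩
    change ((φ.symm (e.symm (e (φ ⟨y, hy⟩))) : H) : G R) = y
    simp

theorem uniq (hf : ∀ u : R, f u ≠ 0 → IsUnit u) (H₁ H₂ : Subgroup (G R))
    (φ₁ : H₁ ≃* G (ZMod 3)) (φ₂ : H₂ ≃* G (ZMod 3)) :
    ∃ g : G R, Subgroup.map (MulAut.conj g).toMonoidHom H₁ = H₂ := by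
  obtain ⟨σ, hσ, rfl⟩ := exists_sec f hf H₁ φ₁
  obtain ⟨τ, hτ, rfl⟩ := exists_sec f hf H₂ φ₂
  obtain ⟨g, hg⟩ := sec_conj f hf σ τ hσ hτ
  refine ⟨g, ?_⟩
  rw [MonoidHom.map_range]
  congr 1
  ext1 x
  exact hg x

set_option maxHeartbeats 4000000 in
theorem exist (hf : ∀ u : R, f u ≠ 0 → IsUnit u) (c : R) (hc : 3 * c ^ 2 - 4 * c + 2 = 0)
    (M : G R) (hM : M.val = !![1, -3; 1, -2]) :
    ∃ H : Subgroup (G R), Nonempty (H ≃* G (ZMod 3)) ∧ M ∈ H := by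
  have hfc : f c = 2 := by
    have h := congrArg f hc
    simp only [map_add, map_sub, map_mul, map_pow, map_ofNat, map_zero] at h
    generalize f c = y at h
    revert y; decide
  have e2 : f 2 = 2 := map_ofNat f 2
  have e3 : f 3 = 3 := map_ofNat f 3
  have e4 : f 4 = 4 := map_ofNat f 4
  have e5 : f 5 = 5 := map_ofNat f 5
  have e6 : f 6 = 6 := map_ofNat f 6
  obtain ⟨I, hI⟩ : ∃ I : G R, I.val = !![1, 3*c-4; c, -1] :=
    ⟨⟨!![1, 3*c-4; c, -1], -!![1, 3*c-4; c, -1], by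
      ext i j; fin_cases i <;> fin_cases j <;> simp <;> grind, by
      ext i j; fin_cases i <;> fin_cases j <;> simp <;> grind⟩, rfl⟩
  obtain ⟨J, hJ⟩ : ∃ J : G R, J.val = !![3*c-1, 2-6*c; c, 1-3*c] :=
    ⟨⟨!![3*c-1, 2-6*c; c, 1-3*c], -!![3*c-1, 2-6*c; c, 1-3*c], by
      ext i j; fin_cases i <;> fin_cases j <;> simp <;> grind, by
      ext i j; fin_cases i <;> fin_cases j <;> simp <;> grind⟩, rfl⟩
  obtain ⟨E, hE⟩ : ∃ E : G R, E.val = !![3-3*c, 6*c-5; 2-2*c, 3*c-3] :=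
    ⟨⟨!![3-3*c, 6*c-5; 2-2*c, 3*c-3], !![3-3*c, 6*c-5; 2-2*c, 3*c-3], by
      ext i j; fin_cases i <;> fin_cases j <;> simp <;> grind, by
      ext i j; fin_cases i <;> fin_cases j <;> simp <;> grind⟩, rfl⟩
  have rI : red f I = i0 := by
    apply Units.ext
    rw [red_coe, hI]
    ext i j; fin_cases i <;> fin_cases j <;> simp [i0, hfc, e2, e3, e4, e5, e6] <;> decide
  have rJ : red f J = j0 := by
    apply Units.ext
    rw [red_coe, hJ]
    ext i j; fin_cases i <;> fin_cases j <;> simp [j0, hfc, e2, e3, e4, e5, e6] <;> decide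
  have rE : red f E = w0 := by
    apply Units.ext
    rw [red_coe, hE]
    ext i j; fin_cases i <;> fin_cases j <;> simp [w0, hfc, e2, e3, e4, e5, e6] <;> decide
  have rM : (red f M).val = !![1,0;1,1] := by
    rw [red_coe, hM]
    ext i j; fin_cases i <;> fin_cases j <;> simp [e2, e3] <;> decide
  have hIJ : I * J = -(J * I) := by
    apply Units.ext
    rw [Units.val_neg, Units.val_mul, Units.val_mul, hI, hJ]
    ext i j; fin_cases i <;> fin_cases j <;> simp <;> grind
  have hMI : M * I = J * M := by
    apply Units.ext
    rw [Units.val_mul, Units.val_mul, hI, hJ, hM]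
    ext i j; fin_cases i <;> fin_cases j <;> simp <;> grind
  have hMJ : M * J = J * I * M := by
    apply Units.ext
    rw [Units.val_mul, Units.val_mul, Units.val_mul, hI, hJ, hM]
    ext i j; fin_cases i <;> fin_cases j <;> simp <;> grind
  have hMK : M * (J * I) = I * M := by
    apply Units.ext
    rw [Units.val_mul, Units.val_mul, Units.val_mul, hI, hJ, hM]
    ext i j; fin_cases i <;> fin_cases j <;> simp <;> grind
  have hEI : E * I = J * E := by
    apply Units.ext
    rw [Units.val_mul, Units.val_mul, hI, hJ, hE]
    ext i j; fin_cases i <;> fin_cases j <;> simp <;> grind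
  have hEJ : E * J = I * E := by
    apply Units.ext
    rw [Units.val_mul, Units.val_mul, hI, hJ, hE]
    ext i j; fin_cases i <;> fin_cases j <;> simp <;> grind
  have hEK : E * (J * I) = -(J * I) * E := by
    rw [← mul_assoc, hEJ, mul_assoc, hEI, ← mul_assoc, hIJ]
  have hIK : I * (J * I) = -(J * I) * I := by
    rw [← mul_assoc, hIJ]
  let Q : Set (G R) := {I, -I, J, -J, J * I, -(J * I)}
  have hQ : ∀ A : G R, (∃ q ∈ Q, A * I = q * A) → (∃ q ∈ Q, A * J = q * A) →
      (∃ q ∈ Q, A * (J * I) = q * A) → A ∈ Subgroup.normalizer Q := by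
    rintro A ⟨q1, m1, h1⟩ ⟨q2, m2, h2⟩ ⟨q3, m3, h3⟩
    have hneg : ∀ q ∈ Q, -q ∈ Q := by
      rintro q (rfl | rfl | rfl | rfl | rfl | rfl) <;> simp [Q]
    apply Subgroup.mem_normalizer_fintype
    rintro n (rfl | rfl | rfl | rfl | rfl | rfl)
    · rw [h1, mul_inv_cancel_right]; exact m1
    · rw [mul_neg, h1, neg_mul, mul_inv_cancel_right]; exact hneg _ m1
    · rw [h2, mul_inv_cancel_right]; exact m2
    · rw [mul_neg, h2, neg_mul, mul_inv_cancel_right]; exact hneg _ m2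
    · rw [h3, mul_inv_cancel_right]; exact m3
    · rw [mul_neg, h3, neg_mul, mul_inv_cancel_right]; exact hneg _ m3
  have nM : M ∈ Subgroup.normalizer Q :=
    hQ M ⟨J, by simp [Q], hMI⟩ ⟨J * I, by simp [Q], hMJ⟩ ⟨I, by simp [Q], hMK⟩
  have nI : I ∈ Subgroup.normalizer Q :=
    hQ I ⟨I, by simp [Q], rfl⟩ ⟨-J, by simp [Q], by rw [hIJ, neg_mul]⟩
      ⟨-(J * I), by simp [Q], hIK⟩
  have nE : E ∈ Subgroup.normalizer Q :=
    hQ E ⟨J, by simp [Q], hEI⟩ ⟨I, by simp [Q], hEJ⟩ ⟨-(J * I), by simp [Q], hEK⟩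
  let δ : G R →* Rˣ := (powMonoidHom 2).comp Matrix.GeneralLinearGroup.det
  have dd : ∀ A : G R, A.val.det ^ 2 = 1 → A ∈ δ.ker := by
    intro A hA
    rw [MonoidHom.mem_ker]
    exact Units.ext hA
  have dM : M ∈ δ.ker := dd M (by rw [hM, Matrix.det_fin_two_of]; ring)
  have dI : I ∈ δ.ker := dd I (by rw [hI, Matrix.det_fin_two_of]; grind)
  have dE : E ∈ δ.ker := dd E (by rw [hE, Matrix.det_fin_two_of]; grind)
  let H : Subgroup (G R) := Subgroup.normalizer Q ⊓ δ.ker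
  have mM : M ∈ H := ⟨nM, dM⟩
  have mI : I ∈ H := ⟨nI, dI⟩
  have mE : E ∈ H := ⟨nE, dE⟩
  have mJ : J ∈ H := by
    have : J = M * I * M⁻¹ := by rw [hMI, mul_inv_cancel_right]
    rw [this]
    exact H.mul_mem (H.mul_mem mM mI) (H.inv_mem mM)
  refine ⟨H, ⟨MulEquiv.ofBijective ((red f).comp H.subtype) ⟨?_, ?_⟩⟩, mM⟩
  · rw [injective_iff_map_eq_one]
    rintro ⟨A, nA, dA⟩ hA
    change red f A = 1 at hA
    apply Subtype.ext
    change A = 1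
    have nA' := Subgroup.mem_set_normalizer_iff.1 nA
    have qI : A * I * A⁻¹ = I := by
      have h1 : A * I * A⁻¹ ∈ Q := (nA' I).1 (by simp [Q])
      have h2 : red f (A * I * A⁻¹) = i0 := by
        rw [map_mul, map_mul, map_inv, hA, rI]; simp
      generalize A * I * A⁻¹ = q at h1 h2
      rcases h1 with rfl | rfl | rfl | rfl | rfl | rfl
      · rfl
      all_goals
        exfalso
        simp only [red_neg, map_mul, rI, rJ] at h2
        revert h2
        decide
    have qJ : A * J * A⁻¹ = J := by
      have h1 : A * J * A⁻¹ ∈ Q := (nA' J).1 (by simp [Q])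
      have h2 : red f (A * J * A⁻¹) = j0 := by
        rw [map_mul, map_mul, map_inv, hA, rJ]; simp
      generalize A * J * A⁻¹ = q at h1 h2
      rcases h1 with rfl | rfl | rfl | rfl | rfl | rfl
      · exfalso
        simp only [red_neg, map_mul, rI, rJ] at h2
        revert h2
        decide
      · exfalso
        simp only [red_neg, map_mul, rI, rJ] at h2
        revert h2
        decide
      · rfl
      all_goals
        exfalso
        simp only [red_neg, map_mul, rI, rJ] at h2
        revert h2
        decide
    have hs := scal f hf A.val I.val J.val (by rw [← red_coe, rI]; rfl)
      (by rw [← red_coe, rJ]; rfl) (congrArg Units.val (mul_inv_eq_iff_eq_mul.1 qI))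
      (congrArg Units.val (mul_inv_eq_iff_eq_mul.1 qJ))
    have hd : A.val.det ^ 2 = 1 := congrArg Units.val (MonoidHom.mem_ker.1 dA)
    rw [hs] at hd
    simp only [Matrix.det_smul, Matrix.det_one, Fintype.card_fin, mul_one] at hd
    apply pow8 f hf A hA
    apply Units.ext
    rw [Units.val_pow_eq_pow_val, hs, smul_pow, one_pow, Units.val_one]
    have : A.val 0 0 ^ 8 = 1 := by linear_combination (A.val 0 0 ^ 4 + 1) * hd
    rw [this, one_smul]
  · intro x
    obtain ⟨a, b, c', d, h, hx⟩ := entries x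
    obtain ⟨m, n, p, q, hw⟩ := F5 a b c' d h
    refine ⟨⟨M ^ m.1 * I ^ n.1 * J ^ p.1 * E ^ q.1, H.mul_mem (H.mul_mem (H.mul_mem
      (H.pow_mem mM _) (H.pow_mem mI _)) (H.pow_mem mJ _)) (H.pow_mem mE _)⟩, ?_⟩
    change red f (M ^ m.1 * I ^ n.1 * J ^ p.1 * E ^ q.1) = x
    apply Units.ext
    simp only [map_mul, map_pow, rI, rJ, rE, Units.val_mul, Units.val_pow_eq_pow_val]
    rw [rM, hx, hw]
    rfl

end

end GL2Lift

/-- For `k ≥ 2` there is a subgroup of `GL₂(ℤ/3ᵏ)` isomorphic to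
`GL₂(𝔽₃)` containing the matrix `[[1,-3],[1,-2]]`, and any two such subgroups
are conjugate in `GL₂(ℤ/3ᵏ)`. -/
theorem gl2_lift_exists_unique_gamma0 (k : ℕ) (hk : 2 ≤ k)
    (M : Matrix.GeneralLinearGroup (Fin 2) (ZMod (3 ^ k)))
    (hM : (M : Matrix (Fin 2) (Fin 2) (ZMod (3 ^ k))) = !![1, -3; 1, -2]) :
    (∃ H : Subgroup (Matrix.GeneralLinearGroup (Fin 2) (ZMod (3 ^ k))),
        Nonempty (H ≃* Matrix.GeneralLinearGroup (Fin 2) (ZMod 3)) ∧ M ∈ H) ∧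
    ∀ H₁ H₂ : Subgroup (Matrix.GeneralLinearGroup (Fin 2) (ZMod (3 ^ k))),
      Nonempty (H₁ ≃* Matrix.GeneralLinearGroup (Fin 2) (ZMod 3)) → M ∈ H₁ →
      Nonempty (H₂ ≃* Matrix.GeneralLinearGroup (Fin 2) (ZMod 3)) → M ∈ H₂ →
      ∃ g : Matrix.GeneralLinearGroup (Fin 2) (ZMod (3 ^ k)),
        Subgroup.map (MulAut.conj g).toMonoidHom H₁ = H₂ := by
  have h3 : 3 ∣ 3 ^ k := dvd_pow_self 3 (by omega)
  have hf := GL2Lift.unit_of_cast k h3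
  constructor
  · obtain ⟨c, hc⟩ := GL2Lift.henselZ k
    refine GL2Lift.exist (ZMod.castHom h3 (ZMod 3)) hf (c : ZMod (3 ^ k)) ?_ M hM
    have h := (ZMod.intCast_zmod_eq_zero_iff_dvd _ (3 ^ k)).2 (by exact_mod_cast hc)
    exact_mod_cast h
  · rintro H₁ H₂ ⟨φ₁⟩ _ ⟨φ₂⟩ _
    exact GL2Lift.uniq (ZMod.castHom h3 (ZMod 3)) hf H₁ H₂ φ₁ φ₂
end

section
/- Let k ≥ 2 be an integer. There exists a subgroup H of GL₂(ℤ/3ᵏ) that is isomorphic (as an abstract group) to SL₂(𝔽₃) and contains the matrix [[1,-3],[1,(-3)^{k-1}-2]]. Moreover, any two subgroups of GL₂(ℤ/3ᵏ) that are isomorphic to SL₂(𝔽₃) and contain this matrix are conjugate in GL₂(ℤ/3ᵏ). -/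
namespace SL2Lift

abbrev G := Matrix.SpecialLinearGroup (Fin 2) (ZMod 3)

/-- quaternion coordinates of a matrix over `ZMod 3` -/
def cA (p _q _r s : ZMod 3) : ZMod 3 := -(p + s)
def cB (_p q r _s : ZMod 3) : ZMod 3 := q - r
def cC (p q r s : ZMod 3) : ZMod 3 := p + q + r - s
def cD (p q r s : ZMod 3) : ZMod 3 := q + r + s - p
def chi (p q r s : ZMod 3) : ZMod 3 := cA p q r s * cB p q r s * cC p q r s * cD p q r s
def lft (x : ZMod 3) : ℤ := if x = 0 then 0 else if x = 1 then 1 else -1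
def sc (p q r s : ZMod 3) : ℤ := if chi p q r s = 0 then 2 else -1
def F0 (p q r s : ZMod 3) : ℤ := sc p q r s * lft (cA p q r s)
def F1 (p q r s : ZMod 3) : ℤ := sc p q r s * lft (cB p q r s)
def F2 (p q r s : ZMod 3) : ℤ := sc p q r s * lft (cC p q r s)
def F3 (p q r s : ZMod 3) : ℤ := sc p q r s * lft (cD p q r s)

set_option maxRecDepth 100000 in
theorem mulF : ∀ p q r s : ZMod 3, p * s - q * r = 1 → ∀ px qx rx sx : ZMod 3,
    px * sx - qx * rx = 1 →
    (F0 p q r s * F0 px qx rx sx - F1 p q r s * F1 px qx rx sx - F2 p q r s * F2 px qx rx sx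
      - F3 p q r s * F3 px qx rx sx =
      2 * F0 (p*px+q*rx) (p*qx+q*sx) (r*px+s*rx) (r*qx+s*sx)) ∧
    (F0 p q r s * F1 px qx rx sx + F1 p q r s * F0 px qx rx sx + F2 p q r s * F3 px qx rx sx
      - F3 p q r s * F2 px qx rx sx =
      2 * F1 (p*px+q*rx) (p*qx+q*sx) (r*px+s*rx) (r*qx+s*sx)) ∧
    (F0 p q r s * F2 px qx rx sx - F1 p q r s * F3 px qx rx sx + F2 p q r s * F0 px qx rx sx
      + F3 p q r s * F1 px qx rx sx =
      2 * F2 (p*px+q*rx) (p*qx+q*sx) (r*px+s*rx) (r*qx+s*sx)) ∧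
    (F0 p q r s * F3 px qx rx sx + F1 p q r s * F2 px qx rx sx - F2 p q r s * F1 px qx rx sx
      + F3 p q r s * F0 px qx rx sx =
      2 * F3 (p*px+q*rx) (p*qx+q*sx) (r*px+s*rx) (r*qx+s*sx)) ∧
    chi (p*px+q*rx) (p*qx+q*sx) (r*px+s*rx) (r*qx+s*sx) = chi p q r s + chi px qx rx sx := by
  decide +kernel

theorem redF : ∀ p q r s : ZMod 3, p * s - q * r = 1 →
    (-((F0 p q r s : ZMod 3) + F2 p q r s - F3 p q r s) = p) ∧
    (-(-(F1 p q r s : ZMod 3) + F2 p q r s + F3 p q r s) = q) ∧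
    (-((F1 p q r s : ZMod 3) + F2 p q r s + F3 p q r s) = r) ∧
    (-((F0 p q r s : ZMod 3) - F2 p q r s + F3 p q r s) = s) := by
  decide +kernel

theorem sqrt_exists (k : ℕ) (hk : 1 ≤ k) : ∃ a : ℤ, (3:ℤ)^k ∣ a^2 + 2 ∧ (3:ℤ) ∣ a - 1 := by
  induction k, hk using Nat.le_induction with
  | base => exact ⟨1, by norm_num, by norm_num⟩
  | succ k hk ih =>
    obtain ⟨a, ⟨t, ht⟩, ⟨v, hv⟩⟩ := ih
    obtain ⟨j, rfl⟩ : ∃ j, k = j + 1 := ⟨k - 1, by omega⟩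
    have ha : a = 1 + 3 * v := by linarith
    refine ⟨a + 3^(j+1) * t, ⟨t * (1 + 2 * v) + 3^j * t^2, ?_⟩, ⟨v + 3^j * t, ?_⟩⟩
    · have : (a + 3^(j+1) * t)^2 + 2 = (a^2 + 2) + 2 * a * 3^(j+1) * t + 3^(j+1) * 3^(j+1) * t^2 := by ring
      rw [this, ht, ha]; ring
    · rw [ha]; ring

/-- squares generate -/
theorem sq_gen : ∀ x : G, ∃ y z : G, x = y ^ 2 * z ^ 2 := by decide +kernel

theorem comm3 : ∀ x : G, x ^ 3 = 1 → x ≠ 1 → ∃ y : G, (x * y * x⁻¹ * y⁻¹) ^ 3 ≠ 1 := by decide +kernel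

theorem pow24 : ∀ x : G, x ^ 24 = 1 := by decide +kernel


theorem S_mul : ∀ y x : G, y ^ 4 = 1 → (x ^ 4 = 1 ↔ (y * x) ^ 4 = 1) := by decide +kernel

def m0 : G := ⟨!![1, 0; 1, 1], by decide⟩
def i0 : G := ⟨!![0, -1; 1, 0], by decide⟩
def j0 : G := ⟨!![1, 1; 1, -1], by decide⟩

theorem S_gen : ∀ x : G, ∃ y : G, ∃ e : Fin 3, y ^ 4 = 1 ∧ x = y * m0 ^ (e : ℕ) := by decide +kernel

theorem S_card : (Finset.univ.filter (fun x : G => x ^ 4 = 1)).card = 8 := by decide +kernel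

theorem dvd3 {k : ℕ} (hk : 2 ≤ k) : 3 ∣ 3 ^ k := dvd_pow_self 3 (by omega)

/-- reduction mod 3 -/
abbrev red {k : ℕ} (hk : 2 ≤ k) : ZMod (3 ^ k) →+* ZMod 3 := ZMod.castHom (dvd3 hk) (ZMod 3)

theorem isUnit_of_red {k : ℕ} (hk : 2 ≤ k) (x : ZMod (3 ^ k)) (h : red hk x ≠ 0) : IsUnit x := by
  have : NeZero (3 ^ k) := ⟨by positivity⟩
  rw [← ZMod.natCast_zmod_val x, ZMod.isUnit_iff_coprime]
  rw [← ZMod.natCast_zmod_val x, map_natCast, Ne, ZMod.natCast_eq_zero_iff] at h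
  exact Nat.Coprime.pow_right _ ((Nat.Prime.coprime_iff_not_dvd Nat.prime_three).2 h).symm

theorem dvd_of_red {k : ℕ} (hk : 2 ≤ k) (x : ZMod (3 ^ k)) (h : red hk x = 0) : ∃ y, x = 3 * y := by
  have : NeZero (3 ^ k) := ⟨by positivity⟩
  rw [← ZMod.natCast_zmod_val x, map_natCast, ZMod.natCast_eq_zero_iff] at h
  obtain ⟨y, hy⟩ := h
  exact ⟨y, by rw [← ZMod.natCast_zmod_val x, hy]; push_cast; rfl⟩

theorem three_pow_zero (k : ℕ) : (3 : ZMod (3 ^ k)) ^ k = 0 := by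
  have := ZMod.natCast_self (3 ^ k)
  push_cast at this
  exact this

theorem pow_of_red {k : ℕ} (hk : 2 ≤ k) (X : Matrix (Fin 2) (Fin 2) (ZMod (3 ^ k)))
    (h : (red hk).mapMatrix X = 1) : X ^ (3 ^ k) = 1 := by
  have h1 : ∀ i j, ∃ y, (X - 1) i j = 3 * y := by
    intro i j
    apply dvd_of_red hk
    have : (red hk).mapMatrix (X - 1) = 0 := by rw [map_sub, h, map_one, sub_self]
    exact congrFun (congrFun this i) j
  choose Y hY using h1
  have hX : X = 1 + (3 : ZMod (3 ^ k)) ^ (0 + 1) • (Matrix.of Y) := by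
    rw [← sub_eq_iff_eq_add']
    ext i j
    simp [hY]
  have key : ∀ m : ℕ, ∃ Z : Matrix (Fin 2) (Fin 2) (ZMod (3 ^ k)),
      X ^ (3 ^ m) = 1 + (3 : ZMod (3 ^ k)) ^ (m + 1) • Z := by
    intro m
    induction m with
    | zero => exact ⟨Matrix.of Y, by rw [pow_zero, pow_one]; exact hX⟩
    | succ m ih =>
      obtain ⟨Z, hZ⟩ := ih
      refine ⟨Z + (3 : ZMod (3 ^ k)) ^ (m + 1) • Z ^ 2 + (3 : ZMod (3 ^ k)) ^ (2 * m + 1) • Z ^ 3, ?_⟩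
      rw [pow_succ 3 m, pow_mul, hZ]
      have e : ∀ t : ZMod (3 ^ k), (1 + t • Z) ^ 3 = 1 + (3 * t) • Z + (3 * t ^ 2) • Z ^ 2 + t ^ 3 • Z ^ 3 := by
        intro t
        have hc : Commute (1 : Matrix (Fin 2) (Fin 2) (ZMod (3 ^ k))) (t • Z) := Commute.one_left _
        have h3 : (1 + t • Z) ^ 3 = 1 + 3 • (t • Z) + 3 • (t • Z) ^ 2 + (t • Z) ^ 3 := by
          generalize t • Z = W
          noncomm_ring
        rw [h3, smul_pow, smul_pow, ← Nat.cast_smul_eq_nsmul (ZMod (3 ^ k)), ← Nat.cast_smul_eq_nsmul (ZMod (3 ^ k)),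
          smul_smul, smul_smul]
        norm_num
      rw [e]
      simp only [smul_add, smul_smul]
      rw [add_assoc, add_assoc, add_assoc]
      congr 4 <;> ring
  obtain ⟨Z, hZ⟩ := key k
  rw [hZ, pow_succ, three_pow_zero]
  simp

/-- an abstract embedding is, up to automorphism, a section of reduction -/
theorem exists_section {k : ℕ} (hk : 2 ≤ k)
    (H : Subgroup (Matrix.GeneralLinearGroup (Fin 2) (ZMod (3 ^ k)))) (e : H ≃* G) :
    ∃ σ : G →* Matrix.GeneralLinearGroup (Fin 2) (ZMod (3 ^ k)), σ.range = H ∧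
      ∀ x, (red hk).mapMatrix (σ x : Matrix (Fin 2) (Fin 2) (ZMod (3 ^ k))) = (x : Matrix (Fin 2) (Fin 2) (ZMod 3)) := by
  let τ : G →* Matrix.GeneralLinearGroup (Fin 2) (ZMod (3 ^ k)) := H.subtype.comp e.symm.toMonoidHom
  have hτi : Function.Injective τ := H.subtype_injective.comp e.symm.injective
  have hτr : τ.range = H := by
    ext x
    constructor
    · rintro ⟨y, rfl⟩; exact (e.symm y).2
    · intro hx; exact ⟨e ⟨x, hx⟩, by simp [τ]⟩
  let ρ : G →* Matrix.GeneralLinearGroup (Fin 2) (ZMod 3) := (Matrix.GeneralLinearGroup.map (red hk)).comp τ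
  have hρ : ∀ x, (ρ x : Matrix (Fin 2) (Fin 2) (ZMod 3)) = (red hk).mapMatrix (τ x : Matrix (Fin 2) (Fin 2) (ZMod (3 ^ k))) := by
    intro x; rfl
  have hker : ∀ x, ρ x = 1 → x ^ 3 = 1 := by
    intro x hx
    have h1 : (τ x) ^ (3 ^ k) = 1 := by
      apply Units.ext
      rw [Units.val_pow_eq_pow_val]
      apply pow_of_red hk
      rw [← hρ, hx]; rfl
    rw [← map_pow, ← map_one τ] at h1
    have h2 := hτi h1
    have h3 := orderOf_dvd_of_pow_eq_one h2
    have h4 := orderOf_dvd_of_pow_eq_one (pow24 x)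
    apply orderOf_dvd_iff_pow_eq_one.1
    have : Nat.Coprime (orderOf x) 8 := by
      apply Nat.Coprime.coprime_dvd_left h3
      exact Nat.Coprime.pow_left k (by norm_num)
    exact this.dvd_of_dvd_mul_right (by simpa using h4)
  have hinj : Function.Injective ρ := by
    rw [injective_iff_map_eq_one]
    intro x hx
    by_contra hne
    obtain ⟨y, hy⟩ := comm3 x (hker x hx) hne
    apply hy
    apply hker
    simp [hx]
  have hdet : ∀ x, (ρ x : Matrix (Fin 2) (Fin 2) (ZMod 3)).det = 1 := by
    have h2 : ∀ u : (ZMod 3)ˣ, u ^ 2 = 1 := by decide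
    intro x
    obtain ⟨y, z, rfl⟩ := sq_gen x
    have : Matrix.GeneralLinearGroup.det (ρ (y ^ 2 * z ^ 2)) = 1 := by
      rw [map_mul, map_pow, map_pow, map_mul, map_pow, map_pow, h2, h2, one_mul]
    simpa using congrArg Units.val this
  let α : G →* G :=
    { toFun := fun x => ⟨(ρ x : Matrix (Fin 2) (Fin 2) (ZMod 3)), hdet x⟩
      map_one' := by ext1; simp
      map_mul' := by intro x y; exact Subtype.ext (congrArg Units.val (map_mul ρ x y)) }
  have hα : Function.Bijective α := by
    rw [← Finite.injective_iff_bijective]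
    intro x y hxy
    apply hinj
    apply Units.ext
    exact congrArg Subtype.val hxy
  let β : G ≃* G := MulEquiv.ofBijective α hα
  refine ⟨τ.comp β.symm.toMonoidHom, ?_, ?_⟩
  · rw [← hτr]
    ext x
    constructor
    · rintro ⟨y, rfl⟩; exact ⟨β.symm y, rfl⟩
    · rintro ⟨y, rfl⟩; exact ⟨β y, by simp⟩
  · intro x
    obtain ⟨y, rfl⟩ := β.surjective x
    have : (τ.comp β.symm.toMonoidHom) (β y) = τ y := by simp
    rw [this, ← hρ]
    rfl

theorem scalar_of_commute {k : ℕ} (hk : 2 ≤ k) (I J X : Matrix (Fin 2) (Fin 2) (ZMod (3 ^ k)))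
    (hI : (red hk).mapMatrix I = !![0, -1; 1, 0]) (hJ : (red hk).mapMatrix J = !![1, 1; 1, -1])
    (hIX : I * X = X * I) (hJX : J * X = X * J) : ∃ d : ZMod (3 ^ k), X = d • 1 := by
  have i00 : red hk (I 0 0) = 0 := congrFun (congrFun hI 0) 0
  have i01 : red hk (I 0 1) = -1 := congrFun (congrFun hI 0) 1
  have i11 : red hk (I 1 1) = 0 := congrFun (congrFun hI 1) 1
  have j00 : red hk (J 0 0) = 1 := congrFun (congrFun hJ 0) 0
  have j01 : red hk (J 0 1) = 1 := congrFun (congrFun hJ 0) 1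
  have j11 : red hk (J 1 1) = -1 := congrFun (congrFun hJ 1) 1
  have e1 := congrFun (congrFun hIX 0) 1
  have e2 := congrFun (congrFun hJX 0) 1
  have e3 := congrFun (congrFun hIX 0) 0
  simp only [Matrix.mul_apply, Fin.sum_univ_two] at e1 e2 e3
  have u1 : IsUnit ((I 0 0 - I 1 1) * J 0 1 - (J 0 0 - J 1 1) * I 0 1) := by
    apply isUnit_of_red hk
    simp only [map_sub, map_mul, i00, i01, i11, j00, j01, j11]
    decide
  have u2 : IsUnit (I 0 1) := by
    apply isUnit_of_red hk
    rw [i01]; decide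
  have hb : X 0 1 = 0 := by
    apply u1.mul_right_eq_zero.1
    linear_combination (J 0 1) * e1 - (I 0 1) * e2
  have hd : X 1 1 - X 0 0 = 0 := by
    apply u2.mul_right_eq_zero.1
    linear_combination e1 + (I 1 1 - I 0 0) * hb
  have hc : X 1 0 = 0 := by
    apply u2.mul_right_eq_zero.1
    linear_combination e3 + (I 1 0) * hb
  refine ⟨X 0 0, ?_⟩
  ext i j
  fin_cases i <;> fin_cases j <;> simp [hb, hc, sub_eq_zero.1 hd]

theorem unique_aux {k : ℕ} (hk : 2 ≤ k)
    (σ₁ σ₂ : G →* Matrix.GeneralLinearGroup (Fin 2) (ZMod (3 ^ k)))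
    (h₁ : ∀ x, (red hk).mapMatrix (σ₁ x : Matrix (Fin 2) (Fin 2) (ZMod (3 ^ k))) = (x : Matrix (Fin 2) (Fin 2) (ZMod 3)))
    (h₂ : ∀ x, (red hk).mapMatrix (σ₂ x : Matrix (Fin 2) (Fin 2) (ZMod (3 ^ k))) = (x : Matrix (Fin 2) (Fin 2) (ZMod 3)))
    (hm : σ₁ m0 = σ₂ m0)
    (htr : IsUnit (σ₂ m0 : Matrix (Fin 2) (Fin 2) (ZMod (3 ^ k))).trace) :
    ∃ P : Matrix.GeneralLinearGroup (Fin 2) (ZMod (3 ^ k)), ∀ x, P * σ₁ x * P⁻¹ = σ₂ x := by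
  let S := Finset.univ.filter (fun x : G => x ^ 4 = 1)
  let g : Matrix (Fin 2) (Fin 2) (ZMod (3 ^ k)) := ∑ x ∈ S, (σ₂ x).val * (σ₁ x⁻¹).val
  have hg : (red hk).mapMatrix g = 8 • 1 := by
    simp only [g, map_sum, map_mul, h₁, h₂]
    rw [Finset.sum_congr rfl (g := fun _ => 1), Finset.sum_const, S_card]
    intro x _
    rw [← Matrix.SpecialLinearGroup.coe_mul, mul_inv_cancel, Matrix.SpecialLinearGroup.coe_one]
  have hgu : IsUnit g := by
    rw [Matrix.isUnit_iff_isUnit_det]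
    apply isUnit_of_red hk
    rw [RingHom.map_det, hg]
    decide
  obtain ⟨P, hP⟩ := hgu
  have hcomm : ∀ y : G, y ^ 4 = 1 → σ₂ y * P = P * σ₁ y := by
    intro y hy
    rw [← mul_inv_eq_iff_eq_mul]
    apply Units.ext
    rw [Units.val_mul, Units.val_mul, hP, ← map_inv]
    simp only [g, Finset.mul_sum, Finset.sum_mul]
    apply Finset.sum_equiv (Equiv.mulLeft y)
    · intro x
      simp only [S, Finset.mem_filter, Finset.mem_univ, true_and, Equiv.coe_mulLeft]
      exact S_mul y x hy
    · intro x _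
      simp only [Equiv.coe_mulLeft, mul_inv_rev, map_mul, Units.val_mul, mul_assoc]
  let σ : G →* Matrix.GeneralLinearGroup (Fin 2) (ZMod (3 ^ k)) := (MulAut.conj P).toMonoidHom.comp σ₁
  have hσ : ∀ x, σ x = P * σ₁ x * P⁻¹ := fun x => rfl
  have hS : ∀ y : G, y ^ 4 = 1 → σ y = σ₂ y := by
    intro y hy
    rw [hσ, ← hcomm y hy, mul_inv_cancel_right]
  have hD : ∀ y : G, y ^ 4 = 1 → σ₂ y * ((σ₂ m0)⁻¹ * σ m0) = ((σ₂ m0)⁻¹ * σ m0) * σ₂ y := by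
    intro y hy
    have h4 : (m0 * y * m0⁻¹) ^ 4 = 1 := by rw [conj_pow, hy]; simp
    have := hS _ h4
    rw [map_mul, map_mul, map_mul, map_mul, hS y hy, map_inv, map_inv, mul_inv_eq_iff_eq_mul] at this
    rw [mul_assoc, this]; group
  obtain ⟨d, hd⟩ := scalar_of_commute hk (σ₂ i0).val (σ₂ j0).val ((σ₂ m0)⁻¹ * σ m0).val
    (by rw [h₂]; rfl) (by rw [h₂]; rfl)
    (by simpa only [Units.val_mul] using congrArg Units.val (hD i0 (by decide)))
    (by simpa only [Units.val_mul] using congrArg Units.val (hD j0 (by decide)))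
  have hsm : (σ m0).val = d • (σ₂ m0).val := by
    have : σ m0 = σ₂ m0 * ((σ₂ m0)⁻¹ * σ m0) := by group
    rw [this, Units.val_mul, hd]; simp
  have ht : (σ m0).val.trace = (σ₂ m0).val.trace := by
    rw [hσ, hm, Units.val_mul, Matrix.trace_mul_comm, ← Units.val_mul, ← mul_assoc, inv_mul_cancel, one_mul]
  have hd1 : d = 1 := by
    rw [hsm, Matrix.trace_smul, smul_eq_mul] at ht
    exact htr.mul_right_cancel (by rw [ht, one_mul])
  have hmm : σ m0 = σ₂ m0 := Units.ext (by rw [hsm, hd1, one_smul])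
  refine ⟨P, fun x => ?_⟩
  rw [← hσ]
  obtain ⟨y, e, hy, rfl⟩ := S_gen x
  rw [map_mul, map_mul, map_pow, map_pow, hS y hy, hmm]

set_option maxHeartbeats 2000000 in
theorem exists_hom {k : ℕ} (hk : 2 ≤ k) (c : ZMod (3 ^ k)) (h3c : 3 * c = 0) (hcc : c * c = 0)
    (hc : red hk c = 0) :
    ∃ τ : G →* Matrix.GeneralLinearGroup (Fin 2) (ZMod (3 ^ k)),
      (∀ x, (red hk).mapMatrix (τ x : Matrix (Fin 2) (Fin 2) (ZMod (3 ^ k))) = (x : Matrix (Fin 2) (Fin 2) (ZMod 3)))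
      ∧ (τ m0).val.trace = c - 1 ∧ (τ m0).val.det = 1 + c := by
  obtain ⟨ax, ⟨t, ht⟩, ⟨v, hv⟩⟩ := sqrt_exists k (by omega)
  obtain ⟨a, ha, ha1⟩ : ∃ a : ZMod (3 ^ k), a ^ 2 = -2 ∧ red hk a = 1 := by
    refine ⟨ax, ?_, ?_⟩
    · have := congrArg (Int.cast : ℤ → ZMod (3 ^ k)) ht
      push_cast at this
      rw [three_pow_zero, zero_mul] at this
      linear_combination this
    · have : ax = 1 + 3 * v := by linarith
      rw [this, map_intCast]; push_cast
      rw [show (3 : ZMod 3) = 0 from rfl]; ring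
  have u2 : IsUnit (2 : ZMod (3 ^ k)) := isUnit_of_red hk _ (by rw [map_ofNat]; decide)
  obtain ⟨h, hh⟩ := u2.exists_right_inv
  have rh : red hk h = -1 := by
    have := congrArg (red hk) hh
    rw [map_mul, map_ofNat, map_one] at this
    generalize red hk h = y at this
    revert this; revert y; decide
  let tw : ZMod 3 → ZMod (3 ^ k) := fun x => 1 + c * (x.val : ZMod (3 ^ k))
  have htw : ∀ x y, tw (x + y) = tw x * tw y := by
    intro x y
    have h1 : c * ((x + y).val : ZMod (3 ^ k)) = c * x.val + c * y.val := by
      have h2 : ∀ x y : ZMod 3, ∃ n : ℕ, n < 2 ∧ x.val + y.val = (x + y).val + 3 * n := by decide +kernel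
      obtain ⟨n, _, hn⟩ := h2 x y
      have := congrArg (Nat.cast : ℕ → ZMod (3 ^ k)) hn
      push_cast at this
      linear_combination (-c) * this - n * h3c
    simp only [tw, h1]
    linear_combination (-(x.val : ZMod (3 ^ k)) * y.val) * hcc
  have rtw : ∀ x, red hk (tw x) = 1 := by intro x; simp only [tw, map_add, map_mul, hc, map_one]; ring
  let f : ZMod 3 → ZMod 3 → ZMod 3 → ZMod 3 → Matrix (Fin 2) (Fin 2) (ZMod (3 ^ k)) := fun p q r s =>
    (tw (chi p q r s) * h) • !![F0 p q r s + F2 p q r s * a - F3 p q r s, -F1 p q r s + F2 p q r s + F3 p q r s * a;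
      F1 p q r s + F2 p q r s + F3 p q r s * a, F0 p q r s - F2 p q r s * a + F3 p q r s]
  have dG : ∀ x : G, x 0 0 * x 1 1 - x 0 1 * x 1 0 = 1 := by
    intro x; rw [← Matrix.det_fin_two]; exact x.2
  let τ₀ : G →* Matrix (Fin 2) (Fin 2) (ZMod (3 ^ k)) :=
    { toFun := fun x => f (x 0 0) (x 0 1) (x 1 0) (x 1 1)
      map_one' := by
        have e : f 1 0 0 1 = 1 := by
          simp only [f]
          rw [show chi 1 0 0 1 = 0 by decide, show F0 1 0 0 1 = 2 by decide, show F1 1 0 0 1 = 0 by decide,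
            show F2 1 0 0 1 = 0 by decide, show F3 1 0 0 1 = 0 by decide]
          ext i j
          fin_cases i <;> fin_cases j <;> simp [tw, mul_comm h, hh]
        exact e
      map_mul' := by
        intro x y
        obtain ⟨e0, e1, e2, e3, e4⟩ := mulF _ _ _ _ (dG x) _ _ _ _ (dG y)
        have m : ∀ i j, (x * y) i j = x i 0 * y 0 j + x i 1 * y 1 j := by
          intro i j
          rw [Matrix.SpecialLinearGroup.coe_mul, Matrix.mul_apply, Fin.sum_univ_two]
        simp only [m, f, e4, htw]
        have f0 := congrArg (Int.cast : ℤ → ZMod (3 ^ k)) e0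
        have f1 := congrArg (Int.cast : ℤ → ZMod (3 ^ k)) e1
        have f2 := congrArg (Int.cast : ℤ → ZMod (3 ^ k)) e2
        have f3 := congrArg (Int.cast : ℤ → ZMod (3 ^ k)) e3
        push_cast at f0 f1 f2 f3
        rw [Matrix.smul_mul, Matrix.mul_smul, smul_smul]
        have sw : ∀ (A B : ZMod (3 ^ k)) (X Y : Matrix (Fin 2) (Fin 2) (ZMod (3 ^ k))), (2 : ZMod (3 ^ k)) • X = Y →
            (A * B * h) • X = (A * h * (B * h)) • Y := by
          intro A B X Y hXY
          rw [← hXY, smul_smul]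
          congr 1
          linear_combination (-A * B * h) * hh
        apply sw
        ext i j
        fin_cases i <;> fin_cases j
        · simp [Matrix.mul_apply, Fin.sum_univ_two]
          linear_combination -f0 - a * f2 + f3 - (F2 (x 0 0) (x 0 1) (x 1 0) (x 1 1) * F2 (y 0 0) (y 0 1) (y 1 0) (y 1 1) + F3 (x 0 0) (x 0 1) (x 1 0) (x 1 1) * F3 (y 0 0) (y 0 1) (y 1 0) (y 1 1) : ZMod (3 ^ k)) * ha
        · simp [Matrix.mul_apply, Fin.sum_univ_two]
          linear_combination f1 - f2 - a * f3 - (F2 (x 0 0) (x 0 1) (x 1 0) (x 1 1) * F3 (y 0 0) (y 0 1) (y 1 0) (y 1 1) - F3 (x 0 0) (x 0 1) (x 1 0) (x 1 1) * F2 (y 0 0) (y 0 1) (y 1 0) (y 1 1) : ZMod (3 ^ k)) * ha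
        · simp [Matrix.mul_apply, Fin.sum_univ_two]
          linear_combination -f1 - f2 - a * f3 + (F2 (x 0 0) (x 0 1) (x 1 0) (x 1 1) * F3 (y 0 0) (y 0 1) (y 1 0) (y 1 1) - F3 (x 0 0) (x 0 1) (x 1 0) (x 1 1) * F2 (y 0 0) (y 0 1) (y 1 0) (y 1 1) : ZMod (3 ^ k)) * ha
        · simp [Matrix.mul_apply, Fin.sum_univ_two]
          linear_combination -f0 + a * f2 - f3 - (F2 (x 0 0) (x 0 1) (x 1 0) (x 1 1) * F2 (y 0 0) (y 0 1) (y 1 0) (y 1 1) + F3 (x 0 0) (x 0 1) (x 1 0) (x 1 1) * F3 (y 0 0) (y 0 1) (y 1 0) (y 1 1) : ZMod (3 ^ k)) * ha }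
  have hm0 : τ₀ m0 = (tw 2 * h) • !![-1 - a + 1, -1 - 1 - a; 1 - 1 - a, -1 + a - 1] := by
    have : τ₀ m0 = f 1 0 1 1 := rfl
    rw [this]
    simp only [f]
    rw [show chi 1 0 1 1 = 2 by decide, show F0 1 0 1 1 = -1 by decide, show F1 1 0 1 1 = 1 by decide,
      show F2 1 0 1 1 = -1 by decide, show F3 1 0 1 1 = -1 by decide]
    congr 2
    ext i j
    fin_cases i <;> fin_cases j <;> simp <;> ring
  have tw2 : tw 2 = 1 + c * 2 := rfl
  refine ⟨τ₀.toHomUnits, ?_, ?_, ?_⟩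
  · intro x
    rw [MonoidHom.coe_toHomUnits]
    obtain ⟨e0, e1, e2, e3⟩ := redF _ _ _ _ (dG x)
    have : τ₀ x = f (x 0 0) (x 0 1) (x 1 0) (x 1 1) := rfl
    rw [this]
    ext i j
    fin_cases i <;> fin_cases j
    · simp only [f]
      simpa [-ZMod.castHom_apply, rtw, rh, ha1] using e0
    · simp only [f]
      simpa [-ZMod.castHom_apply, rtw, rh, ha1] using e1
    · simp only [f]
      simpa [-ZMod.castHom_apply, rtw, rh, ha1] using e2
    · simp only [f]
      simpa [-ZMod.castHom_apply, rtw, rh, ha1] using e3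
  · rw [MonoidHom.coe_toHomUnits, hm0, Matrix.trace_smul, Matrix.trace_fin_two, tw2]
    simp
    linear_combination (-1 - c * 2) * hh - h3c
  · rw [MonoidHom.coe_toHomUnits, hm0, Matrix.det_smul, Matrix.det_fin_two_of, tw2, Fintype.card_fin]
    linear_combination (-2 * ((1 + c * 2) * h) ^ 2) * ha + ((1 + c * 2) ^ 2 * (2 * h + 1)) * hh + h3c + 4 * hcc

end SL2Lift

open SL2Lift in
/-- For `k ≥ 2` there is a subgroup of `GL₂(ℤ/3ᵏ)` isomorphic to
`SL₂(𝔽₃)` containing the matrix `[[1,-3],[1,(-3)^(k-1)-2]]`, and any two such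
subgroups are conjugate in `GL₂(ℤ/3ᵏ)`. -/
theorem sl2_lift_exists_unique_gamma1 (k : ℕ) (hk : 2 ≤ k)
    (M : Matrix.GeneralLinearGroup (Fin 2) (ZMod (3 ^ k)))
    (hM : (M : Matrix (Fin 2) (Fin 2) (ZMod (3 ^ k))) =
      !![1, -3; 1, (-3 : ZMod (3 ^ k)) ^ (k - 1) - 2]) :
    (∃ H : Subgroup (Matrix.GeneralLinearGroup (Fin 2) (ZMod (3 ^ k))),
        Nonempty (H ≃* Matrix.SpecialLinearGroup (Fin 2) (ZMod 3)) ∧ M ∈ H) ∧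
    ∀ H₁ H₂ : Subgroup (Matrix.GeneralLinearGroup (Fin 2) (ZMod (3 ^ k))),
      Nonempty (H₁ ≃* Matrix.SpecialLinearGroup (Fin 2) (ZMod 3)) → M ∈ H₁ →
      Nonempty (H₂ ≃* Matrix.SpecialLinearGroup (Fin 2) (ZMod 3)) → M ∈ H₂ →
      ∃ g : Matrix.GeneralLinearGroup (Fin 2) (ZMod (3 ^ k)),
        Subgroup.map (MulAut.conj g).toMonoidHom H₁ = H₂ := by
  obtain ⟨c, hcdef⟩ : ∃ c : ZMod (3 ^ k), c = (-3) ^ (k - 1) := ⟨_, rfl⟩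
  rw [← hcdef] at hM
  have hn : (-3 : ZMod (3 ^ k)) ^ k = 0 := by rw [neg_pow, three_pow_zero, mul_zero]
  have h3c : 3 * c = 0 := by
    have : (-3 : ZMod (3 ^ k)) * c = 0 := by
      rw [hcdef, ← pow_succ', Nat.sub_add_cancel (by omega), hn]
    linear_combination -this
  have hcc : c * c = 0 := by
    rw [hcdef, ← pow_add, show k - 1 + (k - 1) = k + (k - 2) by omega, pow_add, hn, zero_mul]
  have hc : red hk c = 0 := by
    rw [hcdef, map_pow, map_neg, map_ofNat, show (-3 : ZMod 3) = 0 from rfl, zero_pow (by omega)]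
  have hredM : (red hk).mapMatrix M.val = (m0 : Matrix (Fin 2) (Fin 2) (ZMod 3)) := by
    rw [hM]
    have e0 : red hk 1 = 1 := map_one _
    have e1 : red hk (-3) = 0 := by rw [map_neg, map_ofNat]; rfl
    have e2 : red hk (c - 2) = 1 := by rw [map_sub, hc, map_ofNat]; rfl
    ext i j
    fin_cases i <;> fin_cases j
    · exact e0
    · exact e1
    · exact e0
    · exact e2
  constructor
  · obtain ⟨τ, hτ, htr, hdet⟩ := exists_hom hk c h3c hcc hc
    have hinj : Function.Injective τ := by
      intro x y hxy
      apply Subtype.ext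
      have hx := hτ x
      rw [hxy, hτ y] at hx
      exact hx.symm
    have hr : IsUnit ((τ m0).val 1 0) := by
      apply isUnit_of_red hk
      have : red hk ((τ m0).val 1 0) = 1 := congrFun (congrFun (hτ m0) 1) 0
      rw [this]; decide
    generalize hT : (τ m0).val = T at htr hdet hr
    have hgu : IsUnit (!![T 1 0, 1 - T 0 0; 0, 1] : Matrix (Fin 2) (Fin 2) (ZMod (3 ^ k))) := by
      rw [Matrix.isUnit_iff_isUnit_det, Matrix.det_fin_two_of]
      simpa using hr
    obtain ⟨g, hg⟩ := hgu
    have hconj : g * τ m0 = M * g := by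
      apply Units.ext
      rw [Units.val_mul, Units.val_mul, hg, hT, hM]
      rw [Matrix.trace_fin_two] at htr
      rw [Matrix.det_fin_two] at hdet
      ext i j
      fin_cases i <;> fin_cases j <;> simp [Matrix.mul_apply, Fin.sum_univ_two]
      · ring
      · linear_combination htr - hdet
      · linear_combination htr
    refine ⟨((MulAut.conj g).toMonoidHom.comp τ).range, ⟨?_⟩, ⟨m0, ?_⟩⟩
    · exact (MonoidHom.ofInjective (f := (MulAut.conj g).toMonoidHom.comp τ)
        ((MulAut.conj g).injective.comp hinj)).symm
    · change g * τ m0 * g⁻¹ = M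
      rw [hconj, mul_inv_cancel_right]
  · rintro H₁ H₂ ⟨e₁⟩ hM₁ ⟨e₂⟩ hM₂
    obtain ⟨σ₁, r₁, h₁⟩ := exists_section hk H₁ e₁
    obtain ⟨σ₂, r₂, h₂⟩ := exists_section hk H₂ e₂
    have hm : ∀ σ : G →* Matrix.GeneralLinearGroup (Fin 2) (ZMod (3 ^ k)), M ∈ σ.range →
        (∀ x, (red hk).mapMatrix (σ x).val = (x : Matrix (Fin 2) (Fin 2) (ZMod 3))) → σ m0 = M := by
      rintro σ ⟨x, hx⟩ h
      have : m0 = x := by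
        apply Subtype.ext
        have hz := h x
        rw [hx, hredM] at hz
        exact hz
      rw [this, hx]
    have hm₁ := hm σ₁ (r₁ ▸ hM₁) h₁
    have hm₂ := hm σ₂ (r₂ ▸ hM₂) h₂
    obtain ⟨P, hP⟩ := unique_aux hk σ₁ σ₂ h₁ h₂ (hm₁.trans hm₂.symm) (by
      rw [hm₂, hM, Matrix.trace_fin_two_of]
      apply isUnit_of_red hk
      rw [map_add, map_one, map_sub, hc, map_ofNat]
      decide)
    refine ⟨P, ?_⟩
    rw [← r₁, ← r₂, MonoidHom.map_range]
    congr 1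
    ext1 x
    exact hP x
end
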